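/- arXiv:quant-ph/0012115 — 3 statements merged into one kernel-verified Lean document; each statement's English description precedes it below -/
import Mathlib

section
/- A discrete instrument (I_x)_{x∈X} on ℂ^d is quasi-complete if and only if its information gain is nonnegative for every initial state, i.e. if and only if S(ρ) − Σ_{x: p_x>0} p_x S(ρ_x) ≥ 0 for every density matrix ρ on ℂ^d, where p_x = Tr I_x[ρ] and ρ_x = I_x[ρ]/p_x. -/
open Matrix
open scoped ComplexOrder
noncomputable section

/-- A density matrix on `ℂ^d`: positive semidefinite with trace 1. -/
def IsDensity {d : ℕ} (ρ : Matrix (Fin d) (Fin d) ℂ) : Prop :=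
  ρ.PosSemidef ∧ ρ.trace = 1

/-- A pure density matrix: a rank-one orthogonal projection. -/
def IsPure {d : ℕ} (ρ : Matrix (Fin d) (Fin d) ℂ) : Prop :=
  ρ.IsHermitian ∧ ρ * ρ = ρ ∧ ρ.rank = 1

/-- The von Neumann entropy `S(ρ) = -∑ᵢ λᵢ log λᵢ` of a (Hermitian) matrix,
where `λᵢ` are its eigenvalues (with the convention `0 log 0 = 0`). -/
def vnEntropy {d : ℕ} (ρ : Matrix (Fin d) (Fin d) ℂ) : ℝ :=
  if h : ρ.IsHermitian then ∑ i, Real.negMulLog (h.eigenvalues i) else 0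


theorem aux_spectral {d : ℕ} {τ : Matrix (Fin d) (Fin d) ℂ} (h : τ.IsHermitian) :
    ∃ W : Matrix (Fin d) (Fin d) ℂ, W * Wᴴ = 1 ∧ Wᴴ * W = 1 ∧
      τ = W * diagonal (fun i => (h.eigenvalues i : ℂ)) * Wᴴ := by
  refine ⟨h.eigenvectorUnitary, ?_, ?_, ?_⟩
  · exact Unitary.coe_mul_star_self _
  · exact Unitary.coe_star_mul_self _
  · have := h.spectral_theorem
    rw [Unitary.conjStarAlgAut_apply] at this
    exact this

theorem aux_diag_entry {d : ℕ} (Q : Matrix (Fin d) (Fin d) ℂ) (μ : Fin d → ℝ) (i : Fin d) :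
    (Q * diagonal (fun i => (μ i : ℂ)) * Qᴴ) i i =
      ((∑ k, Complex.normSq (Q i k) * μ k : ℝ) : ℂ) := by
  rw [Matrix.mul_apply]
  push_cast
  refine Finset.sum_congr rfl fun k _ => ?_
  rw [Matrix.mul_diagonal, Matrix.conjTranspose_apply, Complex.normSq_eq_conj_mul_self]
  simp only [RCLike.star_def]
  ring

theorem aux_rowsum {d : ℕ} (Q : Matrix (Fin d) (Fin d) ℂ) (h : Q * Qᴴ = 1) (i : Fin d) :
    ∑ k, Complex.normSq (Q i k) = 1 := by
  have := aux_diag_entry Q (fun _ => 1) i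
  simp only [Complex.ofReal_one, Matrix.diagonal_one, mul_one, h, Matrix.one_apply_eq] at this
  exact_mod_cast this.symm

theorem vnEntropy_of {d : ℕ} {τ : Matrix (Fin d) (Fin d) ℂ} (h : τ.IsHermitian) :
    vnEntropy τ = ∑ i, Real.negMulLog (h.eigenvalues i) := by
  simp [vnEntropy, h]

theorem aux_peierls {d : ℕ} {τ : Matrix (Fin d) (Fin d) ℂ} (h : τ.PosSemidef)
    (U : Matrix (Fin d) (Fin d) ℂ) (h1 : U * Uᴴ = 1) (h2 : Uᴴ * U = 1) :
    vnEntropy τ ≤ ∑ i, Real.negMulLog ((Uᴴ * τ * U) i i).re := by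
  obtain ⟨W, w1, w2, hW⟩ := aux_spectral h.1
  set μ := h.1.eigenvalues with hμ
  set Q := Uᴴ * W with hQ
  have hQQ : Q * Qᴴ = 1 := by
    rw [hQ, conjTranspose_mul, conjTranspose_conjTranspose, Matrix.mul_assoc,
      ← Matrix.mul_assoc W, w1, Matrix.one_mul, h2]
  have hQQ' : Qᴴ * Qᴴᴴ = 1 := by
    rw [hQ, conjTranspose_mul, conjTranspose_conjTranspose, conjTranspose_mul,
      conjTranspose_conjTranspose, Matrix.mul_assoc,
      ← Matrix.mul_assoc U, h1, Matrix.one_mul, w2]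
  have key : Uᴴ * τ * U = Q * diagonal (fun i => (μ i : ℂ)) * Qᴴ := by
    rw [hW, hQ, conjTranspose_mul, conjTranspose_conjTranspose]
    simp only [Matrix.mul_assoc]
  rw [vnEntropy_of h.1, key]
  have col : ∀ k, ∑ i, Complex.normSq (Q i k) = 1 := by
    intro k
    have := aux_rowsum _ hQQ' k
    simpa [Matrix.conjTranspose_apply] using this
  calc ∑ k, Real.negMulLog (μ k)
      = ∑ i, ∑ k, Complex.normSq (Q i k) • Real.negMulLog (μ k) := by
        rw [Finset.sum_comm]
        refine Finset.sum_congr rfl fun k _ => ?_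
        rw [← Finset.sum_smul, col, one_smul]
    _ ≤ _ := by
        refine Finset.sum_le_sum fun i _ => ?_
        rw [aux_diag_entry, Complex.ofReal_re]
        exact Real.concaveOn_negMulLog.le_map_sum (fun k _ => Complex.normSq_nonneg _)
          (aux_rowsum _ hQQ i) (fun k _ => h.eigenvalues_nonneg k)

theorem aux_entropy_nonneg {d : ℕ} {τ : Matrix (Fin d) (Fin d) ℂ} (h : τ.PosSemidef)
    (ht : τ.trace = 1) : (∀ i, h.1.eigenvalues i ≤ 1) ∧ ∑ i, h.1.eigenvalues i = 1 := by
  have hs : ∑ i, h.1.eigenvalues i = 1 := by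
    have := h.1.trace_eq_sum_eigenvalues
    rw [ht] at this
    have := congrArg Complex.re this
    simpa using this.symm
  refine ⟨fun i => ?_, hs⟩
  rw [← hs]
  exact Finset.single_le_sum (f := h.1.eigenvalues) (fun j _ => h.eigenvalues_nonneg j)
    (Finset.mem_univ i)

theorem vnEntropy_nonneg {d : ℕ} {τ : Matrix (Fin d) (Fin d) ℂ} (h : τ.PosSemidef)
    (ht : τ.trace = 1) : 0 ≤ vnEntropy τ := by
  rw [vnEntropy_of h.1]
  exact Finset.sum_nonneg fun i _ =>
    Real.negMulLog_nonneg (h.eigenvalues_nonneg i) ((aux_entropy_nonneg h ht).1 i)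

theorem vnEntropy_pure {d : ℕ} {τ : Matrix (Fin d) (Fin d) ℂ} (h : τ.IsHermitian)
    (hp : τ * τ = τ) : vnEntropy τ = 0 := by
  rw [vnEntropy_of h]
  refine Finset.sum_eq_zero fun i _ => ?_
  obtain ⟨W, w1, w2, hW⟩ := aux_spectral h
  have hD : Wᴴ * τ * W = diagonal (fun i => (h.eigenvalues i : ℂ)) := by
    conv_lhs => rw [hW]
    rw [← Matrix.mul_assoc, ← Matrix.mul_assoc, w2, Matrix.one_mul, Matrix.mul_assoc, w2,
      Matrix.mul_one]
  have hDD : (Wᴴ * τ * W) * (Wᴴ * τ * W) = Wᴴ * τ * W := by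
    calc _ = Wᴴ * (τ * (W * Wᴴ) * τ) * W := by simp only [Matrix.mul_assoc]
      _ = _ := by rw [w1, Matrix.mul_one, hp]
  rw [hD, diagonal_mul_diagonal] at hDD
  have := congrFun (diagonal_injective hDD) i
  have h3 : h.eigenvalues i * h.eigenvalues i = h.eigenvalues i := by exact_mod_cast this
  have h4 : h.eigenvalues i = 0 ∨ h.eigenvalues i = 1 := by
    by_cases h0 : h.eigenvalues i = 0
    · exact Or.inl h0
    · exact Or.inr (mul_left_cancel₀ h0 (by rw [h3, mul_one]))
  rcases h4 with h4 | h4 <;> simp [h4]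

theorem pure_of_vnEntropy {d : ℕ} {τ : Matrix (Fin d) (Fin d) ℂ} (h : τ.PosSemidef)
    (ht : τ.trace = 1) (h0 : vnEntropy τ ≤ 0) : IsPure τ := by
  have hn := vnEntropy_nonneg h ht
  have he := aux_entropy_nonneg h ht
  have h00 := le_antisymm h0 hn
  rw [vnEntropy_of h.1, Finset.sum_eq_zero_iff_of_nonneg (fun i _ =>
    Real.negMulLog_nonneg (h.eigenvalues_nonneg i) (he.1 i))] at h00
  have h01 : ∀ i, h.1.eigenvalues i = 0 ∨ h.1.eigenvalues i = 1 := by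
    intro i
    have := h00 i (Finset.mem_univ i)
    have hnn := h.eigenvalues_nonneg i
    simp only [Real.negMulLog, mul_eq_zero, neg_eq_zero, Real.log_eq_zero] at this
    rcases this with h | h | h | h
    · exact Or.inl h
    · exact Or.inl h
    · exact Or.inr h
    · rw [h] at hnn; norm_num at hnn
  refine ⟨h.1, ?_, ?_⟩
  · obtain ⟨W, w1, w2, hW⟩ := aux_spectral h.1
    set D := diagonal (fun i => (h.1.eigenvalues i : ℂ)) with hD
    have hDD : D * D = D := by
      rw [hD, diagonal_mul_diagonal]
      congr 1
      funext i
      rcases h01 i with h | h <;> simp [h]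
    calc τ * τ = (W * D * Wᴴ) * (W * D * Wᴴ) := by rw [← hW]
      _ = W * (D * (Wᴴ * W) * D) * Wᴴ := by simp only [Matrix.mul_assoc]
      _ = τ := by rw [w2, Matrix.mul_one, hDD, ← hW]
  · rw [h.1.rank_eq_card_non_zero_eigs, Fintype.card_subtype]
    have h2 := he.2
    have : ∀ i, h.1.eigenvalues i = if h.1.eigenvalues i ≠ 0 then 1 else 0 := by
      intro i
      rcases h01 i with h | h <;> simp [h]
    rw [Finset.sum_congr rfl (fun i _ => this i), Finset.sum_boole] at h2
    exact_mod_cast h2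

theorem vnEntropy_charpoly {d : ℕ} {σ τ : Matrix (Fin d) (Fin d) ℂ} (h : σ.IsHermitian)
    (h' : τ.IsHermitian) (hc : σ.charpoly = τ.charpoly) : vnEntropy σ = vnEntropy τ := by
  rw [vnEntropy_of h, vnEntropy_of h', (h.eigenvalues_eq_eigenvalues_iff h').2 hc]

theorem aux_psd_conj_diag {d : ℕ} {τ : Matrix (Fin d) (Fin d) ℂ} (h : τ.PosSemidef)
    (U : Matrix (Fin d) (Fin d) ℂ) (i : Fin d) : 0 ≤ ((Uᴴ * τ * U) i i).re := by
  have := (h.conjTranspose_mul_mul_same U).diag_nonneg (i := i)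
  exact (Complex.le_def.1 this).1

theorem vnEntropy_concave {d : ℕ} {X : Type*} [Fintype X]
    (σ : X → Matrix (Fin d) (Fin d) ℂ) (hσ : ∀ x, (σ x).PosSemidef)
    (ht : (∑ x, σ x).trace = 1) :
    ∑ x, (if 0 < (σ x).trace.re then
          (σ x).trace.re * vnEntropy (((σ x).trace)⁻¹ • σ x) else 0) ≤ vnEntropy (∑ x, σ x) := by
  have hS : (∑ x, σ x).IsHermitian := by
    have : (∑ x, σ x).PosSemidef := posSemidef_sum _ fun x _ => hσ x
    exact this.1
  obtain ⟨W, w1, w2, hW⟩ := aux_spectral hS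
  have hD : Wᴴ * (∑ x, σ x) * W = diagonal (fun i => (hS.eigenvalues i : ℂ)) := by
    conv_lhs => rw [hW]
    rw [← Matrix.mul_assoc, ← Matrix.mul_assoc, w2, Matrix.one_mul, Matrix.mul_assoc, w2,
      Matrix.mul_one]
  set p : X → ℝ := fun x => (σ x).trace.re with hp
  set s : X → Fin d → ℝ := fun x i => ((Wᴴ * σ x * W) i i).re with hs
  have hpc : ∀ x, (σ x).trace = (p x : ℂ) := by
    intro x
    have := (hσ x).trace_nonneg
    rw [Complex.le_def] at this
    apply Complex.ext
    · simp [hp]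
    · simpa using this.2.symm
  have hp0 : ∀ x, 0 ≤ p x := fun x => (Complex.le_def.1 (hσ x).trace_nonneg).1
  have hp1 : ∑ x, p x = 1 := by
    rw [trace_sum] at ht
    simp only [hpc] at ht
    exact_mod_cast ht
  have hs0 : ∀ x i, 0 ≤ s x i := fun x i => aux_psd_conj_diag (hσ x) W i
  have hsum : ∀ x, ∑ i, s x i = p x := by
    intro x
    have : (Wᴴ * σ x * W).trace = (σ x).trace := by
      rw [trace_mul_comm, ← Matrix.mul_assoc, w1, Matrix.one_mul]
    rw [hp]
    simp only
    rw [← this, Matrix.trace, Complex.re_sum]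
    rfl
  have hsz : ∀ x i, p x = 0 → s x i = 0 := by
    intro x i h
    have h2 := hsum x
    rw [h, Finset.sum_eq_zero_iff_of_nonneg (fun i _ => hs0 x i)] at h2
    exact h2 i (Finset.mem_univ i)
  have hev : ∀ i, hS.eigenvalues i = ∑ x, s x i := by
    intro i
    have := congrFun (congrFun hD i) i
    rw [diagonal_apply_eq, Finset.mul_sum, Finset.sum_mul, Matrix.sum_apply] at this
    have := congrArg Complex.re this
    rw [Complex.re_sum, Complex.ofReal_re] at this
    exact this.symm
  rw [vnEntropy_of hS]
  calc _ ≤ ∑ x, ∑ i, p x • Real.negMulLog (s x i / p x) := by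
        refine Finset.sum_le_sum fun x _ => ?_
        split_ifs with hx
        · have hx' : 0 < p x := hx
          rw [← Finset.smul_sum, smul_eq_mul]
          refine mul_le_mul_of_nonneg_left ?_ (hp0 x)
          have hps : (((σ x).trace)⁻¹ • σ x).PosSemidef := by
            rw [hpc]
            apply (hσ x).smul
            rw [← Complex.ofReal_inv]
            exact_mod_cast inv_nonneg.2 (hp0 x)
          refine (aux_peierls hps W w1 w2).trans (le_of_eq ?_)
          refine Finset.sum_congr rfl fun i _ => ?_
          congr 1
          rw [Matrix.mul_smul, Matrix.smul_mul, Matrix.smul_apply, hpc, ← Complex.ofReal_inv,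
            smul_eq_mul, Complex.re_ofReal_mul, div_eq_inv_mul]
        · have : p x = 0 := le_antisymm (not_lt.1 hx) (hp0 x)
          simp [this]
    _ = ∑ i, ∑ x, p x • Real.negMulLog (s x i / p x) := Finset.sum_comm
    _ ≤ _ := by
        refine Finset.sum_le_sum fun i _ => ?_
        have := Real.concaveOn_negMulLog.le_map_sum (t := Finset.univ) (w := p)
          (p := fun x => s x i / p x) (fun x _ => hp0 x) hp1
          (fun x _ => div_nonneg (hs0 x i) (hp0 x))
        refine this.trans (le_of_eq ?_)
        rw [hev]
        congr 1
        refine Finset.sum_congr rfl fun x _ => ?_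
        by_cases h : p x = 0
        · simp [h, hsz x i h]
        · rw [smul_eq_mul, mul_div_cancel₀ _ h]

theorem aux_same {E F : Type*} [AddCommGroup E] [Module ℂ E] [AddCommGroup F] [Module ℂ F]
    (A B : E →ₗ[ℂ] F) (H : ∀ w, A w ≠ 0 → ∃ c : ℂ, B w = c • A w) (w y : E) (a : ℂ)
    (hi : ∀ s t : ℂ, s • A w + t • A y = 0 → s = 0 ∧ t = 0) (hy : B y = a • A y) :
    B w = a • A w := by
  have h1 : A w ≠ 0 := by
    intro h
    have := (hi 1 0 (by simp [h])).1
    exact one_ne_zero this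
  have h2 : A (w + y) ≠ 0 := by
    intro h
    have := (hi 1 1 (by simpa using h)).1
    exact one_ne_zero this
  obtain ⟨c, hc⟩ := H w h1
  obtain ⟨c', hc'⟩ := H _ h2
  have h3 : (c - c') • A w + (a - c') • A y = 0 := by
    rw [map_add, map_add, hc, hy] at hc'
    rw [sub_smul, sub_smul, sub_add_sub_comm, hc', smul_add, sub_self]
  obtain ⟨h4, h5⟩ := hi _ _ h3
  rw [hc, sub_eq_zero.1 h4, ← sub_eq_zero.1 h5]

theorem aux_prop {E F : Type*} [AddCommGroup E] [Module ℂ E] [AddCommGroup F] [Module ℂ F]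
    (A B : E →ₗ[ℂ] F) (H : ∀ w, A w ≠ 0 → ∃ c : ℂ, B w = c • A w) (u v : E)
    (hi : ∀ s t : ℂ, s • A u + t • A v = 0 → s = 0 ∧ t = 0) :
    ∃ a : ℂ, ∀ w, B w = a • A w := by
  have hu : A u ≠ 0 := by
    intro h
    exact one_ne_zero (hi 1 0 (by simp [h])).1
  have hv : A v ≠ 0 := by
    intro h
    exact one_ne_zero (hi 0 1 (by simp [h])).2
  obtain ⟨a, ha⟩ := H u hu
  have hi' : ∀ s t : ℂ, s • A v + t • A u = 0 → s = 0 ∧ t = 0 := fun s t h =>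
    (hi t s (by rw [add_comm, h])).symm
  have hb : B v = a • A v := aux_same A B H v u a hi' ha
  refine ⟨a, fun w => ?_⟩
  by_cases c1 : ∀ s t : ℂ, s • A w + t • A u = 0 → s = 0 ∧ t = 0
  · exact aux_same A B H w u a c1 ha
  by_cases c2 : ∀ s t : ℂ, s • A w + t • A v = 0 → s = 0 ∧ t = 0
  · exact aux_same A B H w v a c2 hb
  have dep : ∀ z : E, A z ≠ 0 → (¬ ∀ s t : ℂ, s • A w + t • A z = 0 → s = 0 ∧ t = 0) →
      ∃ k : ℂ, A w = k • A z := by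
    intro z hz h
    push Not at h
    obtain ⟨s, t, h1, h2⟩ := h
    have hs : s ≠ 0 := by
      intro hs
      rw [hs, zero_smul, zero_add, smul_eq_zero] at h1
      exact h2 hs (h1.resolve_right hz)
    refine ⟨-(s⁻¹ * t), ?_⟩
    have : s • A w = -(t • A z) := eq_neg_of_add_eq_zero_left h1
    rw [neg_smul, mul_smul, ← smul_neg, ← this, smul_smul, inv_mul_cancel₀ hs, one_smul]
  obtain ⟨k, hk⟩ := dep u hu c1
  obtain ⟨l, hl⟩ := dep v hv c2
  have hk0 : k = 0 := (hi k (-l) (by rw [← hk, neg_smul, ← hl, add_neg_cancel])).1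
  have hw : A w = 0 := by rw [hk, hk0, zero_smul]
  have := aux_same A B H (w + u) v a (by simpa [hw] using hi) hb
  rw [map_add, map_add, hw, ha, zero_add] at this
  rw [hw, smul_zero]
  simpa using this

theorem aux_structure {E F ι : Type*} [AddCommGroup E] [Module ℂ E] [AddCommGroup F] [Module ℂ F]
    (V : ι → E →ₗ[ℂ] F) (hV : ∀ u, ∃ e : F, ∀ i, ∃ c : ℂ, V i u = c • e) :
    (∃ (A : ι) (c : ι → ℂ), ∀ i w, V i w = c i • V A w) ∨
      ∃ e : F, ∀ i w, ∃ c : ℂ, V i w = c • e := by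
  have H : ∀ i j w, V i w ≠ 0 → ∃ c : ℂ, V j w = c • V i w := by
    intro i j w hw
    obtain ⟨e, he⟩ := hV w
    obtain ⟨a, ha⟩ := he i
    obtain ⟨b, hb⟩ := he j
    have ha0 : a ≠ 0 := by
      rintro rfl
      exact hw (by rw [ha, zero_smul])
    exact ⟨b * a⁻¹, by rw [ha, hb, smul_smul, inv_mul_cancel_right₀ ha0]⟩
  by_cases hr : ∃ j u v, ∀ s t : ℂ, s • V j u + t • V j v = 0 → s = 0 ∧ t = 0
  · left
    obtain ⟨j, u, v, h⟩ := hr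
    choose c hc using fun i => aux_prop (V j) (V i) (H j i) u v h
    exact ⟨j, c, hc⟩
  · right
    have dep : ∀ j u w, V j u ≠ 0 → ∃ k : ℂ, V j w = k • V j u := by
      intro j u w hz
      have h : ¬ ∀ s t : ℂ, s • V j w + t • V j u = 0 → s = 0 ∧ t = 0 := fun h => hr ⟨j, w, u, h⟩
      push Not at h
      obtain ⟨s, t, h1, h2⟩ := h
      have hs : s ≠ 0 := by
        intro hs
        rw [hs, zero_smul, zero_add, smul_eq_zero] at h1
        exact h2 hs (h1.resolve_right hz)
      refine ⟨-(s⁻¹ * t), ?_⟩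
      have : s • V j w = -(t • V j u) := eq_neg_of_add_eq_zero_left h1
      rw [neg_smul, mul_smul, ← smul_neg, ← this, smul_smul, inv_mul_cancel₀ hs, one_smul]
    by_cases hz : ∃ k u, V k u ≠ 0
    · obtain ⟨k, u, hku⟩ := hz
      refine ⟨V k u, fun j w => ?_⟩
      by_cases h1 : V j u = 0
      · by_cases h2 : V k w = 0
        · have := H k j (u + w) (by rw [map_add, h2, add_zero]; exact hku)
          simpa [h1, h2] using this
        · obtain ⟨a, ha⟩ := H k j w h2
          obtain ⟨b, hb⟩ := dep k u w hku
          exact ⟨a * b, by rw [ha, hb, smul_smul]⟩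
      · obtain ⟨a, ha⟩ := dep j u w h1
        obtain ⟨b, hb⟩ := H k j u hku
        exact ⟨a * b, by rw [ha, hb, smul_smul]⟩
    · push Not at hz
      exact ⟨0, fun i w => ⟨0, by rw [hz]; simp⟩⟩

theorem aux_dot_nonneg {d : ℕ} (w : Fin d → ℂ) : 0 ≤ w ⬝ᵥ star w :=
  by rw [dotProduct_comm]; exact dotProduct_star_self_nonneg w

theorem aux_dot_zero {d : ℕ} {w : Fin d → ℂ} (h : w ⬝ᵥ star w = 0) : w = 0 :=
  by rw [dotProduct_comm] at h; exact dotProduct_star_self_eq_zero.1 h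

/-- Vectors whose Gram-type sum is dominated by a rank-one projection are all parallel. -/
theorem aux_range {d m : ℕ} (w : Fin m → Fin d → ℂ) (k : ℂ) (hk : k ≠ 0)
    (hP : IsPure (k • ∑ i, vecMulVec (w i) (star (w i)))) :
    ∃ e : Fin d → ℂ, ∀ i, ∃ c : ℂ, w i = c • e := by
  set P := k • ∑ i, vecMulVec (w i) (star (w i)) with hPdef
  obtain ⟨hh, hpp, hr⟩ := hP
  have h0 : (1 - P) * P * (1 - P)ᴴ = 0 := by
    rw [sub_mul, hpp, one_mul, sub_self, zero_mul]
  have h1 : ∑ i, vecMulVec ((1 - P) *ᵥ w i) (star ((1 - P) *ᵥ w i)) = 0 := by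
    have : k • ∑ i, vecMulVec ((1 - P) *ᵥ w i) (star ((1 - P) *ᵥ w i)) = 0 := by
      rw [← h0]
      conv_rhs => rw [hPdef]
      rw [Matrix.mul_smul, Matrix.smul_mul, Finset.mul_sum, Finset.sum_mul, ← hPdef]
      congr 1
      refine Finset.sum_congr rfl fun i _ => ?_
      rw [mul_vecMulVec, vecMulVec_mul, star_mulVec]
    exact (smul_eq_zero.1 this).resolve_left hk
  have h2 : ∑ i, ((1 - P) *ᵥ w i) ⬝ᵥ star ((1 - P) *ᵥ w i) = 0 := by
    have := congrArg Matrix.trace h1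
    simpa only [trace_sum, trace_vecMulVec, trace_zero] using this
  rw [Finset.sum_eq_zero_iff_of_nonneg (fun i _ => aux_dot_nonneg _)] at h2
  have h3 : ∀ i, P *ᵥ w i = w i := by
    intro i
    have := aux_dot_zero (h2 i (Finset.mem_univ i))
    rw [sub_mulVec, one_mulVec, sub_eq_zero] at this
    exact this.symm
  have h4 : Module.finrank ℂ (LinearMap.range P.mulVecLin) ≤ 1 := le_of_eq hr
  rw [finrank_le_one_iff] at h4
  obtain ⟨v, hv⟩ := h4
  refine ⟨v, fun i => ?_⟩
  obtain ⟨c, hc⟩ := hv ⟨w i, ⟨w i, h3 i⟩⟩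
  exact ⟨c, by simpa using (congrArg Subtype.val hc).symm⟩

theorem aux_pure_state {d : ℕ} (u : Fin d → ℂ) (hu : u ≠ 0) :
    IsDensity ((u ⬝ᵥ star u)⁻¹ • vecMulVec u (star u)) ∧
    IsPure ((u ⬝ᵥ star u)⁻¹ • vecMulVec u (star u)) := by
  have hn : u ⬝ᵥ star u ≠ 0 := fun h => hu (aux_dot_zero h)
  have hps : ((u ⬝ᵥ star u)⁻¹ • vecMulVec u (star u)).PosSemidef :=
    (posSemidef_vecMulVec_self_star u).smul (inv_nonneg.2 (aux_dot_nonneg u))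
  have ht : ((u ⬝ᵥ star u)⁻¹ • vecMulVec u (star u)).trace = 1 := by
    rw [trace_smul, trace_vecMulVec, smul_eq_mul, inv_mul_cancel₀ hn]
  refine ⟨⟨hps, ht⟩, hps.1, ?_, ?_⟩
  · rw [Matrix.smul_mul, Matrix.mul_smul, vecMulVec_mul_vecMulVec, dotProduct_comm (star u) u,
      vecMulVec_smul, smul_smul (u ⬝ᵥ star u)⁻¹ (u ⬝ᵥ star u), inv_mul_cancel₀ hn, one_smul]
  · apply le_antisymm
    · rw [← smul_vecMulVec]
      exact rank_vecMulVec_le _ _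
    · rw [Nat.one_le_iff_ne_zero]
      intro h
      have h : (u ⬝ᵥ star u)⁻¹ • vecMulVec u (star u) = 0 := by
        rw [Matrix.rank, Submodule.finrank_eq_zero, LinearMap.range_eq_bot] at h
        rw [Matrix.ext_iff_mulVec]
        intro v
        have := LinearMap.congr_fun h v
        rw [Matrix.mulVecLin_apply, LinearMap.zero_apply] at this
        rw [this, Matrix.zero_mulVec]
      rw [h] at ht
      simp at ht

theorem aux_sum_vec {d m : ℕ} (V : Fin m → Matrix (Fin d) (Fin d) ℂ) (k : ℂ) (u : Fin d → ℂ) :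
    ∑ i, V i * (k • vecMulVec u (star u)) * (V i)ᴴ =
      k • ∑ i, vecMulVec (V i *ᵥ u) (star (V i *ᵥ u)) := by
  rw [Finset.smul_sum]
  refine Finset.sum_congr rfl fun i _ => ?_
  rw [Matrix.mul_smul, Matrix.smul_mul, mul_vecMulVec, vecMulVec_mul, star_mulVec]

/-- Quasi-completeness of one outcome gives the dichotomy. -/
theorem aux_dichotomy {d m : ℕ} (V : Fin m → Matrix (Fin d) (Fin d) ℂ)
    (h : ∀ ρ : Matrix (Fin d) (Fin d) ℂ, IsDensity ρ → IsPure ρ →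
      0 < (∑ i, V i * ρ * (V i)ᴴ).trace.re →
        IsPure (((∑ i, V i * ρ * (V i)ᴴ).trace)⁻¹ • ∑ i, V i * ρ * (V i)ᴴ)) :
    (∃ (A : Matrix (Fin d) (Fin d) ℂ) (c : Fin m → ℂ), ∀ i, V i = c i • A) ∨
      ∃ e : Fin d → ℂ, ∀ i w, ∃ c : ℂ, V i *ᵥ w = c • e := by
  have hV : ∀ u : Fin d → ℂ, ∃ e : Fin d → ℂ, ∀ i, ∃ c : ℂ, (V i).mulVecLin u = c • e := by
    intro u
    by_cases hu : u = 0
    · exact ⟨0, fun i => ⟨0, by simp [hu]⟩⟩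
    obtain ⟨h1, h2⟩ := aux_pure_state u hu
    have h3 := h _ h1 h2
    rw [aux_sum_vec] at h3
    set k := (u ⬝ᵥ star u)⁻¹ with hk
    have hk0 : k ≠ 0 := inv_ne_zero fun h => hu (aux_dot_zero h)
    have hknn : 0 ≤ k := inv_nonneg.2 (aux_dot_nonneg u)
    have htr : (k • ∑ i, vecMulVec (V i *ᵥ u) (star (V i *ᵥ u))).trace =
        k * ∑ i, (V i *ᵥ u) ⬝ᵥ star (V i *ᵥ u) := by
      rw [trace_smul, trace_sum, smul_eq_mul]
      simp only [trace_vecMulVec]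
    have hnn : 0 ≤ k * ∑ i, (V i *ᵥ u) ⬝ᵥ star (V i *ᵥ u) :=
      mul_nonneg hknn (Finset.sum_nonneg fun i _ => aux_dot_nonneg _)
    by_cases hz : k * ∑ i, (V i *ᵥ u) ⬝ᵥ star (V i *ᵥ u) = 0
    · have hz := (mul_eq_zero.1 hz).resolve_left hk0
      rw [Finset.sum_eq_zero_iff_of_nonneg (fun i _ => aux_dot_nonneg _)] at hz
      refine ⟨0, fun i => ⟨0, ?_⟩⟩
      have := aux_dot_zero (hz i (Finset.mem_univ i))
      simpa using this
    · have hpos := lt_of_le_of_ne hnn (Ne.symm hz)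
      rw [htr] at h3
      have h4 := h3 (Complex.lt_def.1 hpos).1
      rw [smul_smul] at h4
      exact aux_range (fun i => V i *ᵥ u) _ (mul_ne_zero (inv_ne_zero hz) hk0) h4
  rcases aux_structure (fun i => (V i).mulVecLin) hV with ⟨A, c, hA⟩ | ⟨e, he⟩
  · left
    refine ⟨V A, c, fun i => ?_⟩
    rw [Matrix.ext_iff_mulVec]
    intro w
    simpa [smul_mulVec] using hA i w
  · right
    exact ⟨e, he⟩

theorem aux_line_pure {d m : ℕ} (V : Fin m → Matrix (Fin d) (Fin d) ℂ) (e : Fin d → ℂ)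
    (he : ∀ i w, ∃ c : ℂ, V i *ᵥ w = c • e) (ρ : Matrix (Fin d) (Fin d) ℂ) :
    ∃ t : ℂ, ∑ i, V i * ρ * (V i)ᴴ = t • vecMulVec e (star e) := by
  choose c hc using he
  have hV : ∀ i, V i = vecMulVec e (fun k => c i (Pi.single k 1)) := by
    intro i
    ext a k
    have := congrFun (hc i (Pi.single k 1)) a
    rw [mulVec_single_one] at this
    simpa [vecMulVec_apply, mul_comm] using this
  refine ⟨∑ i, (fun k => c i (Pi.single k 1)) ᵥ* ρ ⬝ᵥ star (fun k => c i (Pi.single k 1)), ?_⟩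
  rw [Finset.sum_smul]
  refine Finset.sum_congr rfl fun i _ => ?_
  rw [hV i, conjTranspose_vecMulVec, vecMulVec_mul, vecMulVec_mul_vecMulVec, vecMulVec_smul]

theorem aux_line_entropy {d : ℕ} (τ : Matrix (Fin d) (Fin d) ℂ) (hτ : τ.PosSemidef)
    (htr : τ.trace = 1) (e : Fin d → ℂ) (k : ℂ) (h : τ = k • vecMulVec e (star e)) :
    vnEntropy τ = 0 := by
  apply vnEntropy_pure hτ.1
  have h1 : k * (star e ⬝ᵥ e) = 1 := by
    rw [h, trace_smul, trace_vecMulVec, smul_eq_mul, dotProduct_comm] at htr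
    exact htr
  conv_lhs => rw [h]
  rw [Matrix.smul_mul, Matrix.mul_smul, vecMulVec_mul_vecMulVec, vecMulVec_smul, smul_smul k (star e ⬝ᵥ e), h1,
    one_smul, ← h]

theorem aux_psd_scale {d : ℕ} {M : Matrix (Fin d) (Fin d) ℂ} (h : M.PosSemidef) :
    ((M.trace)⁻¹ • M).PosSemidef :=
  h.smul (inv_nonneg.2 h.trace_nonneg)

theorem aux_trace_scale {d : ℕ} {M : Matrix (Fin d) (Fin d) ℂ} (h : 0 < M.trace.re) :
    ((M.trace)⁻¹ • M).trace = 1 := by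
  rw [trace_smul, smul_eq_mul, inv_mul_cancel₀]
  intro h0
  rw [h0] at h
  simp at h

theorem aux_psd_I {d m : ℕ} (V : Fin m → Matrix (Fin d) (Fin d) ℂ)
    {ρ : Matrix (Fin d) (Fin d) ℂ} (h : ρ.PosSemidef) :
    (∑ i, V i * ρ * (V i)ᴴ).PosSemidef :=
  posSemidef_sum _ fun i _ => h.mul_mul_conjTranspose_same (V i)

theorem aux_psd_dual {d m : ℕ} (V : Fin m → Matrix (Fin d) (Fin d) ℂ)
    (C : Matrix (Fin d) (Fin d) ℂ) :
    (∑ i, C * ((V i)ᴴ * V i) * Cᴴ).PosSemidef :=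
  posSemidef_sum _ fun i _ => (posSemidef_conjTranspose_mul_self (V i)).mul_mul_conjTranspose_same C

theorem aux_trace_dual {d m : ℕ} (V : Fin m → Matrix (Fin d) (Fin d) ℂ)
    (C : Matrix (Fin d) (Fin d) ℂ) :
    (∑ i, V i * (Cᴴ * C) * (V i)ᴴ).trace = (∑ i, C * ((V i)ᴴ * V i) * Cᴴ).trace := by
  rw [trace_sum, trace_sum]
  refine Finset.sum_congr rfl fun i _ => ?_
  calc (V i * (Cᴴ * C) * (V i)ᴴ).trace = ((V i * Cᴴ) * (C * (V i)ᴴ)).trace := by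
        simp only [Matrix.mul_assoc]
    _ = ((C * (V i)ᴴ) * (V i * Cᴴ)).trace := trace_mul_comm _ _
    _ = _ := by simp only [Matrix.mul_assoc]

theorem aux_outcome {d m : ℕ} (V : Fin m → Matrix (Fin d) (Fin d) ℂ)
    (h : ∀ ρ : Matrix (Fin d) (Fin d) ℂ, IsDensity ρ → IsPure ρ →
      0 < (∑ i, V i * ρ * (V i)ᴴ).trace.re →
        IsPure (((∑ i, V i * ρ * (V i)ᴴ).trace)⁻¹ • ∑ i, V i * ρ * (V i)ᴴ))
    (C : Matrix (Fin d) (Fin d) ℂ) (hp : 0 < (∑ i, V i * (Cᴴ * C) * (V i)ᴴ).trace.re) :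
    vnEntropy (((∑ i, V i * (Cᴴ * C) * (V i)ᴴ).trace)⁻¹ • ∑ i, V i * (Cᴴ * C) * (V i)ᴴ) ≤
    vnEntropy (((∑ i, C * ((V i)ᴴ * V i) * Cᴴ).trace)⁻¹ • ∑ i, C * ((V i)ᴴ * V i) * Cᴴ) := by
  have hM := aux_psd_scale (aux_psd_I V (posSemidef_conjTranspose_mul_self C))
  have hN := aux_psd_scale (aux_psd_dual V C)
  rcases aux_dichotomy V h with ⟨A, c, hA⟩ | ⟨e, he⟩
  · apply le_of_eq
    apply vnEntropy_charpoly hM.1 hN.1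
    rw [aux_trace_dual]
    set q := ((∑ i, C * ((V i)ᴴ * V i) * Cᴴ).trace)⁻¹
    have h1 : ∑ i, V i * (Cᴴ * C) * (V i)ᴴ =
        (∑ i, c i * star (c i)) • ((A * Cᴴ) * (C * Aᴴ)) := by
      rw [Finset.sum_smul]
      refine Finset.sum_congr rfl fun i _ => ?_
      rw [hA i, conjTranspose_smul, Matrix.mul_smul, Matrix.smul_mul, Matrix.smul_mul, smul_smul,
        mul_comm (star (c i))]
      simp only [Matrix.mul_assoc]
    have h2 : ∑ i, C * ((V i)ᴴ * V i) * Cᴴ =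
        (∑ i, c i * star (c i)) • ((C * Aᴴ) * (A * Cᴴ)) := by
      rw [Finset.sum_smul]
      refine Finset.sum_congr rfl fun i _ => ?_
      rw [hA i, conjTranspose_smul, Matrix.mul_smul, Matrix.smul_mul, Matrix.mul_smul,
        Matrix.mul_smul, Matrix.smul_mul, Matrix.smul_mul, smul_smul]
      simp only [Matrix.mul_assoc]
    rw [h1, h2, smul_smul, smul_smul, ← Matrix.smul_mul, charpoly_mul_comm, Matrix.mul_smul]
  · obtain ⟨t, ht⟩ := aux_line_pure V e he (Cᴴ * C)
    rw [aux_line_entropy _ hM (aux_trace_scale hp) e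
      (((∑ i, V i * (Cᴴ * C) * (V i)ᴴ).trace)⁻¹ * t) (by rw [mul_smul, ← ht])]
    apply vnEntropy_nonneg hN
    apply aux_trace_scale
    rw [← aux_trace_dual]
    exact hp

theorem aux_factor {d : ℕ} {ρ : Matrix (Fin d) (Fin d) ℂ} (h : ρ.PosSemidef) :
    ∃ C : Matrix (Fin d) (Fin d) ℂ, ρ = Cᴴ * C := by
  obtain ⟨W, w1, w2, hW⟩ := aux_spectral h.1
  refine ⟨diagonal (fun i => ((Real.sqrt (h.1.eigenvalues i) : ℝ) : ℂ)) * Wᴴ, ?_⟩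
  rw [conjTranspose_mul, conjTranspose_conjTranspose, diagonal_conjTranspose, Matrix.mul_assoc,
    ← Matrix.mul_assoc (diagonal _), diagonal_mul_diagonal, ← Matrix.mul_assoc]
  conv_lhs => rw [hW]
  congr 3
  funext i
  simp only [Pi.star_apply, RCLike.star_def, Complex.conj_ofReal]
  rw [← Complex.ofReal_mul, Real.mul_self_sqrt (h.eigenvalues_nonneg i)]

/-- A discrete instrument `(I_x)_{x ∈ X}` is quasi-complete (a posteriori states of pure
states are pure) if and only if its information gain
`S(ρ) − ∑_{x : p_x > 0} p_x S(ρ_x)` is nonnegative for every density matrix `ρ`,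
where `p_x = Tr I_x[ρ]` and `ρ_x = I_x[ρ]/p_x`. -/
theorem quasiComplete_iff_info_gain_nonneg {d : ℕ} {X : Type*} [Fintype X] {m : X → ℕ}
    (I : X → (Matrix (Fin d) (Fin d) ℂ →ₗ[ℂ] Matrix (Fin d) (Fin d) ℂ))
    (V : (x : X) → Fin (m x) → Matrix (Fin d) (Fin d) ℂ)
    (hKraus : ∀ x ρ, I x ρ = ∑ i, V x i * ρ * (V x i)ᴴ)
    (hNorm : ∑ x, ∑ i, (V x i)ᴴ * V x i = 1) :
    (∀ ρ : Matrix (Fin d) (Fin d) ℂ, IsDensity ρ → IsPure ρ →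
        ∀ x, 0 < (I x ρ).trace.re → IsPure (((I x ρ).trace)⁻¹ • I x ρ)) ↔
    (∀ ρ : Matrix (Fin d) (Fin d) ℂ, IsDensity ρ →
        0 ≤ vnEntropy ρ - ∑ x, (if 0 < (I x ρ).trace.re then
          (I x ρ).trace.re * vnEntropy (((I x ρ).trace)⁻¹ • I x ρ) else 0)) := by
  have hI : ∀ x ρ, I x ρ = ∑ i, V x i * ρ * (V x i)ᴴ := hKraus
  constructor
  · intro hq ρ hρ
    obtain ⟨C, hC⟩ := aux_factor hρ.1
    rw [sub_nonneg]
    have hsum : ∑ x, ∑ i, C * ((V x i)ᴴ * V x i) * Cᴴ = C * Cᴴ := by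
      have : ∑ x, ∑ i, C * ((V x i)ᴴ * V x i) * Cᴴ =
          C * (∑ x, ∑ i, (V x i)ᴴ * V x i) * Cᴴ := by
        simp only [Finset.mul_sum, Finset.sum_mul]
      rw [this, hNorm, Matrix.mul_one]
    have hconc := vnEntropy_concave (fun x => ∑ i, C * ((V x i)ᴴ * V x i) * Cᴴ)
      (fun x => aux_psd_dual (V x) C)
      (by rw [hsum, trace_mul_comm, ← hC]; exact hρ.2)
    rw [hsum, vnEntropy_charpoly (posSemidef_self_mul_conjTranspose C).1 hρ.1.1
      (by rw [hC, charpoly_mul_comm])] at hconc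
    refine le_trans (Finset.sum_le_sum fun x _ => ?_) hconc
    have htr : (I x ρ).trace = (∑ i, C * ((V x i)ᴴ * V x i) * Cᴴ).trace := by
      rw [hI, hC, aux_trace_dual]
    rw [← htr]
    split_ifs with hx
    · refine mul_le_mul_of_nonneg_left ?_ hx.le
      have := aux_outcome (V x) (fun ρ h1 h2 => by rw [← hI]; exact hq ρ h1 h2 x) C
        (by rw [← hC, ← hI]; exact hx)
      rw [← hC, ← hI, ← htr] at this
      exact this
    · exact le_refl _
  · intro hg ρ hρ hpure x hx
    have h1 := hg ρ hρ
    rw [vnEntropy_pure hpure.1 hpure.2.1, zero_sub, neg_nonneg] at h1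
    have hpsd : ∀ y, (I y ρ).PosSemidef := fun y => by rw [hI]; exact aux_psd_I _ hρ.1
    have hnn : ∀ y, 0 ≤ (if 0 < (I y ρ).trace.re then
          (I y ρ).trace.re * vnEntropy (((I y ρ).trace)⁻¹ • I y ρ) else 0) := by
      intro y
      split_ifs with hy
      · exact mul_nonneg hy.le (vnEntropy_nonneg (aux_psd_scale (hpsd y)) (aux_trace_scale hy))
      · exact le_refl _
    have h2 := (Finset.single_le_sum (fun y _ => hnn y) (Finset.mem_univ x)).trans h1
    rw [if_pos hx] at h2
    exact pure_of_vnEntropy (aux_psd_scale (hpsd x)) (aux_trace_scale hx)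
      (nonpos_of_mul_nonpos_right h2 hx)
end
end

section
/- Let (I_x)_{x∈X} be a quasi-complete discrete instrument on ℂ^d and let ρ be a density matrix with spectral decomposition ρ = Σ_α w_α ρ_α, where the ρ_α are mutually orthogonal pure density matrices and the weights w_α > 0 sum to 1. Set p_x = Tr I_x[ρ], ρ_x = I_x[ρ]/p_x for p_x > 0, and p_{x|α} = Tr I_x[ρ_α]. Then the information gain dominates the classical amount of information: S(ρ) − Σ_{x: p_x>0} p_x S(ρ_x) ≥ Σ_α w_α Σ_{x: p_x>0} p_{x|α} ln(p_{x|α}/p_x) ≥ 0 (with the convention 0 ln 0 = 0; note p_x = Σ_α w_α p_{x|α}, so p_{x|α} > 0 forces p_x > 0). -/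
open Matrix
open scoped ComplexOrder
noncomputable section

/-- Entropy read off from the roots of a polynomial. -/
def polyEnt (p : Polynomial ℂ) : ℝ := (p.roots.map (fun z => Real.negMulLog z.re)).sum

lemma polyEnt_X_pow_mul (k : ℕ) (p : Polynomial ℂ) (hp : p ≠ 0) :
    polyEnt (Polynomial.X ^ k * p) = polyEnt p := by
  unfold polyEnt
  rw [Polynomial.roots_mul (mul_ne_zero (pow_ne_zero _ Polynomial.X_ne_zero) hp),
    Polynomial.roots_X_pow]
  simp [Multiset.nsmul_singleton]

lemma polyEnt_charpoly {n : Type*} [Fintype n] [DecidableEq n] {M : Matrix n n ℂ}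
    (h : M.IsHermitian) : polyEnt M.charpoly = ∑ i, Real.negMulLog (h.eigenvalues i) := by
  unfold polyEnt
  rw [h.roots_charpoly_eq_eigenvalues, Multiset.map_map]
  rfl

lemma polyEnt_diagonal {n : Type*} [Fintype n] [DecidableEq n] (v : n → ℂ) :
    polyEnt (diagonal v).charpoly = ∑ i, Real.negMulLog (v i).re := by
  unfold polyEnt
  rw [charpoly_diagonal, Polynomial.roots_prod]
  · simp
  · simp [Finset.prod_ne_zero_iff, Polynomial.X_sub_C_ne_zero]

lemma polyEnt_mul_comm {m n : Type*} [Fintype n] [DecidableEq n] [Fintype m] [DecidableEq m]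
    (B : Matrix m n ℂ) (C : Matrix n m ℂ) :
    polyEnt (B * C).charpoly = polyEnt (C * B).charpoly := by
  rw [← polyEnt_X_pow_mul (Fintype.card n) _ (charpoly_monic (B * C)).ne_zero,
    charpoly_mul_comm', polyEnt_X_pow_mul _ _ (charpoly_monic (C * B)).ne_zero]

lemma herm_entry {n : Type*} [Fintype n] [DecidableEq n] {M : Matrix n n ℂ}
    (h : M.IsHermitian) (j k : n) :
    M j k = ∑ i, (h.eigenvectorUnitary : Matrix n n ℂ) j i * (h.eigenvalues i : ℂ) *
      star ((h.eigenvectorUnitary : Matrix n n ℂ) k i) := by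
  conv_lhs => rw [h.spectral_theorem, Unitary.conjStarAlgAut_apply]
  rw [Matrix.mul_apply]
  simp [Matrix.mul_diagonal, Matrix.star_apply]

lemma unitary_row {n : Type*} [Fintype n] [DecidableEq n] (U : Matrix.unitaryGroup n ℂ) (j : n) :
    ∑ i, Complex.normSq ((U : Matrix n n ℂ) j i) = 1 := by
  have h := congrFun (congrFun (Matrix.mem_unitaryGroup_iff.1 U.2) j) j
  rw [Matrix.mul_apply] at h
  simp only [Matrix.star_apply, one_apply_eq, Complex.star_def, Complex.mul_conj] at h
  exact_mod_cast h

lemma unitary_col {n : Type*} [Fintype n] [DecidableEq n] (U : Matrix.unitaryGroup n ℂ) (j : n) :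
    ∑ i, Complex.normSq ((U : Matrix n n ℂ) i j) = 1 := by
  have h := congrFun (congrFun (Matrix.mem_unitaryGroup_iff'.1 U.2) j) j
  rw [Matrix.mul_apply] at h
  simp only [Matrix.star_apply, one_apply_eq, Complex.star_def, ← Complex.normSq_eq_conj_mul_self] at h
  exact_mod_cast h

/-- Schur: the entropy of the spectrum is at most the entropy of the diagonal. -/
lemma polyEnt_le_diag {n : Type*} [Fintype n] [DecidableEq n] {M : Matrix n n ℂ}
    (h : M.PosSemidef) : polyEnt M.charpoly ≤ ∑ j, Real.negMulLog (M j j).re := by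
  have hH := h.1
  rw [polyEnt_charpoly hH]
  have key : ∀ j, ∑ i, Complex.normSq ((hH.eigenvectorUnitary : Matrix n n ℂ) j i) *
      Real.negMulLog (hH.eigenvalues i) ≤ Real.negMulLog (M j j).re := by
    intro j
    have h1 := Real.concaveOn_negMulLog.le_map_sum (t := Finset.univ)
      (w := fun i => Complex.normSq ((hH.eigenvectorUnitary : Matrix n n ℂ) j i))
      (p := hH.eigenvalues) (fun i _ => Complex.normSq_nonneg _) (unitary_row _ j)
      (fun i _ => h.eigenvalues_nonneg i)
    simp only [smul_eq_mul] at h1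
    refine h1.trans (le_of_eq ?_)
    congr 1
    rw [herm_entry hH j j, Complex.re_sum]
    refine Finset.sum_congr rfl fun i _ => ?_
    rw [mul_right_comm, Complex.star_def, Complex.mul_conj, ← Complex.ofReal_mul,
      Complex.ofReal_re]
  refine le_trans (le_of_eq ?_) (Finset.sum_le_sum fun j _ => key j)
  rw [Finset.sum_comm]
  refine Finset.sum_congr rfl fun i _ => ?_
  rw [← Finset.sum_mul, unitary_col, one_mul]

/-- Matrices of the form `φ φ†`. -/
def IsROne {d : ℕ} (N : Matrix (Fin d) (Fin d) ℂ) : Prop :=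
  ∃ φ : Fin d → ℂ, N = vecMulVec φ (star φ)

lemma IsROne.smul {d : ℕ} {N : Matrix (Fin d) (Fin d) ℂ} (h : IsROne N) {c : ℝ} (hc : 0 ≤ c) :
    IsROne ((c : ℂ) • N) := by
  obtain ⟨φ, rfl⟩ := h
  refine ⟨((Real.sqrt c : ℝ) : ℂ) • φ, ?_⟩
  ext i j
  have : (c : ℂ) = (Real.sqrt c : ℂ) * (Real.sqrt c : ℂ) := by
    rw [← Complex.ofReal_mul, Real.mul_self_sqrt hc]
  simp only [Matrix.smul_apply, vecMulVec_apply, Pi.smul_apply, Pi.star_apply, smul_eq_mul,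
    star_mul', Complex.star_def, Complex.conj_ofReal]
  rw [this]; ring

lemma IsPure.isROne {d : ℕ} {P : Matrix (Fin d) (Fin d) ℂ} (h : IsPure P) : IsROne P := by
  obtain ⟨hH, hP, hr⟩ := h
  have hpsd : P.PosSemidef := by
    have := posSemidef_self_mul_conjTranspose P
    rwa [hH.eq, hP] at this
  rw [hH.rank_eq_card_non_zero_eigs, Fintype.card_eq_one_iff] at hr
  obtain ⟨⟨i0, hi0⟩, hu⟩ := hr
  have hz : ∀ i, i ≠ i0 → hH.eigenvalues i = 0 := by
    intro i hi
    by_contra hne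
    exact hi (congrArg Subtype.val (hu ⟨i, hne⟩))
  have : P = ((hH.eigenvalues i0 : ℝ) : ℂ) •
      vecMulVec (fun j => (hH.eigenvectorUnitary : Matrix _ _ ℂ) j i0)
        (star (fun j => (hH.eigenvectorUnitary : Matrix _ _ ℂ) j i0)) := by
    ext j k
    rw [herm_entry hH j k, Finset.sum_eq_single i0]
    · simp only [Matrix.smul_apply, vecMulVec_apply, Pi.star_apply, smul_eq_mul]; ring
    · intro i _ hi
      simp [hz i hi]
    · simp
  rw [this]
  exact IsROne.smul ⟨_, rfl⟩ (hpsd.eigenvalues_nonneg i0)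

lemma vnEntropy_eq_polyEnt {d : ℕ} {M : Matrix (Fin d) (Fin d) ℂ} (h : M.IsHermitian) :
    vnEntropy M = polyEnt M.charpoly := by
  rw [polyEnt_charpoly h, vnEntropy, dif_pos h]

lemma sum_rone {d : ℕ} {A : Type*} [Fintype A] (φ : A → Fin d → ℂ) :
    ∑ a, vecMulVec (φ a) (star (φ a)) =
      (Matrix.of fun i a => φ a i) * (Matrix.of fun i a => φ a i)ᴴ := by
  ext i j
  simp [Matrix.sum_apply, Matrix.mul_apply, vecMulVec_apply]

lemma vnEntropy_sum_le {d : ℕ} {A : Type*} [Fintype A] (N : A → Matrix (Fin d) (Fin d) ℂ)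
    (h : ∀ a, IsROne (N a)) :
    vnEntropy (∑ a, N a) ≤ ∑ a, Real.negMulLog (N a).trace.re := by
  classical
  choose φ hφ using h
  obtain rfl : N = fun a => vecMulVec (φ a) (star (φ a)) := funext hφ
  rw [sum_rone, vnEntropy_eq_polyEnt (posSemidef_self_mul_conjTranspose _).1, polyEnt_mul_comm]
  refine (polyEnt_le_diag (posSemidef_conjTranspose_mul_self _)).trans (le_of_eq ?_)
  refine Finset.sum_congr rfl fun a _ => ?_
  congr 2
  simp [Matrix.trace, Matrix.mul_apply, vecMulVec_apply, mul_comm]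

lemma vnEntropy_sum_eq {d : ℕ} {A : Type*} [Fintype A] (N : A → Matrix (Fin d) (Fin d) ℂ)
    (h : ∀ a, IsROne (N a)) (ho : ∀ a b, a ≠ b → N a * N b = 0) :
    vnEntropy (∑ a, N a) = ∑ a, Real.negMulLog (N a).trace.re := by
  classical
  choose φ hφ using h
  obtain rfl : N = fun a => vecMulVec (φ a) (star (φ a)) := funext hφ
  rw [sum_rone, vnEntropy_eq_polyEnt (posSemidef_self_mul_conjTranspose _).1, polyEnt_mul_comm]
  have : (Matrix.of fun i a => φ a i)ᴴ * (Matrix.of fun i a => φ a i) =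
      diagonal fun a => (vecMulVec (φ a) (star (φ a))).trace := by
    ext a b
    by_cases hab : a = b
    · subst hab
      simp [Matrix.trace, Matrix.mul_apply, vecMulVec_apply, mul_comm]
    · rw [diagonal_apply_ne _ hab]
      have h0 := congrArg Matrix.trace (ho a b hab)
      simp only [vecMulVec_mul_vecMulVec, Matrix.trace_zero] at h0
      have h1 : (star (φ a) ⬝ᵥ φ b) * star (star (φ a) ⬝ᵥ φ b) = 0 := by
        rw [← h0, Matrix.trace_vecMulVec, dotProduct_smul, smul_eq_mul]
        congr 1
        simp [dotProduct, mul_comm]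
      have h2 : star (φ a) ⬝ᵥ φ b = 0 := by simpa using h1
      simpa [Matrix.mul_apply, dotProduct] using h2
  rw [this, polyEnt_diagonal]

/-- Scalar core of the argument. -/
lemma classical_core {X A : Type*} [Fintype X] [Fintype A] (w : A → ℝ) (q : X → A → ℝ)
    (p : X → ℝ) (hw : ∀ a, 0 < w a) (hwsum : ∑ a, w a = 1) (hq : ∀ x a, 0 ≤ q x a)
    (hp : ∀ x, p x = ∑ a, w a * q x a) (hqs : ∀ a, ∑ x, q x a = 1)
    (S : X → ℝ) (hS : ∀ x, 0 < p x → S x ≤ ∑ a, Real.negMulLog (w a * q x a / p x)) :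
    (∑ a, w a * ∑ x, (if 0 < p x then q x a * Real.log (q x a / p x) else 0)) ≤
      (∑ a, Real.negMulLog (w a)) - ∑ x, (if 0 < p x then p x * S x else 0) ∧
    0 ≤ ∑ a, w a * ∑ x, (if 0 < p x then q x a * Real.log (q x a / p x) else 0) := by
  have hq0 : ∀ x, ¬ 0 < p x → ∀ a, q x a = 0 := by
    intro x hx a
    have h1 : ∑ a, w a * q x a = 0 :=
      le_antisymm (by rw [← hp]; exact not_lt.1 hx)
        (Finset.sum_nonneg fun a _ => mul_nonneg (hw a).le (hq x a))
    have h2 := (Finset.sum_eq_zero_iff_of_nonneg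
      (fun a _ => mul_nonneg (hw a).le (hq x a))).1 h1 a (Finset.mem_univ a)
    exact (mul_eq_zero.1 h2).resolve_left (hw a).ne'
  have hswap : (∑ a, w a * ∑ x, (if 0 < p x then q x a * Real.log (q x a / p x) else 0)) =
      ∑ x, ∑ a, w a * (if 0 < p x then q x a * Real.log (q x a / p x) else 0) := by
    rw [Finset.sum_comm]
    exact Finset.sum_congr rfl fun a _ => Finset.mul_sum _ _ _
  rw [hswap]
  constructor
  · have hH : (∑ a, Real.negMulLog (w a)) = ∑ x, ∑ a, Real.negMulLog (w a) * q x a := by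
      rw [Finset.sum_comm]
      refine Finset.sum_congr rfl fun a _ => ?_
      rw [← Finset.mul_sum, hqs, mul_one]
    rw [hH, le_sub_iff_add_le, ← Finset.sum_add_distrib]
    refine Finset.sum_le_sum fun x _ => ?_
    by_cases hx : 0 < p x
    · simp only [if_pos hx]
      have h1 := mul_le_mul_of_nonneg_left (hS x hx) hx.le
      rw [Finset.mul_sum] at h1
      refine (add_le_add_right h1 _).trans (le_of_eq ?_)
      rw [← Finset.sum_add_distrib]
      refine Finset.sum_congr rfl fun a _ => ?_
      rcases (hq x a).eq_or_lt with h0 | h0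
      · simp [← h0]
      · rw [mul_div_assoc]
        unfold Real.negMulLog
        rw [Real.log_mul (hw a).ne' (div_pos h0 hx).ne']
        field_simp
        ring
    · simp [hx, hq0 x hx]
  · refine Finset.sum_nonneg fun x _ => ?_
    by_cases hx : 0 < p x
    · simp only [if_pos hx]
      have h1 : ∑ a, w a * (q x a - p x) = 0 := by
        simp only [mul_sub, Finset.sum_sub_distrib, ← Finset.sum_mul, hwsum, ← hp]
        ring
      rw [← h1]
      refine Finset.sum_le_sum fun a _ => mul_le_mul_of_nonneg_left ?_ (hw a).le
      rcases (hq x a).eq_or_lt with h0 | h0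
      · simp [← h0, hx.le]
      · have h2 := mul_le_mul_of_nonneg_left
          (Real.one_sub_inv_le_log_of_pos (div_pos h0 hx)) h0.le
        refine le_trans (le_of_eq ?_) h2
        field_simp
    · simp [hx]

/-- For a quasi-complete discrete instrument `(I_x)` and a density matrix
`ρ = ∑_α w_α ρ_α` (spectral decomposition into mutually orthogonal pure states with
positive weights summing to 1), the information gain dominates the classical amount
of information:
`S(ρ) − ∑_{x : p_x>0} p_x S(ρ_x) ≥ ∑_α w_α ∑_{x : p_x>0} p_{x|α} ln(p_{x|α}/p_x) ≥ 0`,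
with `p_x = Tr I_x[ρ]`, `ρ_x = I_x[ρ]/p_x`, `p_{x|α} = Tr I_x[ρ_α]`. -/
theorem info_gain_ge_classical_info {d : ℕ} {X : Type*} [Fintype X] {m : X → ℕ}
    (I : X → (Matrix (Fin d) (Fin d) ℂ →ₗ[ℂ] Matrix (Fin d) (Fin d) ℂ))
    (V : (x : X) → Fin (m x) → Matrix (Fin d) (Fin d) ℂ)
    (hKraus : ∀ x ρ, I x ρ = ∑ i, V x i * ρ * (V x i)ᴴ)
    (hNorm : ∑ x, ∑ i, (V x i)ᴴ * V x i = 1)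
    (hqc : ∀ σ : Matrix (Fin d) (Fin d) ℂ, IsDensity σ → IsPure σ →
      ∀ x, 0 < (I x σ).trace.re → IsPure (((I x σ).trace)⁻¹ • I x σ))
    {A : Type*} [Fintype A] (w : A → ℝ) (ρα : A → Matrix (Fin d) (Fin d) ℂ)
    (ρ : Matrix (Fin d) (Fin d) ℂ) (hρ : IsDensity ρ)
    (hw : ∀ α, 0 < w α) (hwsum : ∑ α, w α = 1)
    (hpure : ∀ α, IsDensity (ρα α) ∧ IsPure (ρα α))
    (horth : ∀ α β, α ≠ β → ρα α * ρα β = 0)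
    (hdecomp : ρ = ∑ α, (w α : ℂ) • ρα α) :
    (∑ α, w α * ∑ x, (if 0 < (I x ρ).trace.re then
        (I x (ρα α)).trace.re * Real.log ((I x (ρα α)).trace.re / (I x ρ).trace.re)
      else 0)) ≤
      vnEntropy ρ - ∑ x, (if 0 < (I x ρ).trace.re then
        (I x ρ).trace.re * vnEntropy (((I x ρ).trace)⁻¹ • I x ρ) else 0) ∧
    0 ≤ ∑ α, w α * ∑ x, (if 0 < (I x ρ).trace.re then
        (I x (ρα α)).trace.re * Real.log ((I x (ρα α)).trace.re / (I x ρ).trace.re)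
      else 0) := by
  have hpsd : ∀ x σ, σ.PosSemidef → (I x σ).PosSemidef := by
    intro x σ hσ
    rw [hKraus]
    exact posSemidef_sum _ fun i _ => hσ.mul_mul_conjTranspose_same _
  have htr : ∀ x σ, σ.PosSemidef → (I x σ).trace = ((I x σ).trace.re : ℂ) := by
    intro x σ hσ
    exact Complex.eq_re_of_ofReal_le (r := 0) (by simpa using (hpsd x σ hσ).trace_nonneg)
  have hnn : ∀ x σ, σ.PosSemidef → 0 ≤ (I x σ).trace.re := by
    intro x σ hσ
    exact (Complex.le_def.1 (hpsd x σ hσ).trace_nonneg).1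
  have hone : ∀ x α, IsROne (I x (ρα α)) := by
    intro x α
    obtain ⟨hd, hp⟩ := hpure α
    rcases (hnn x _ hd.1).eq_or_lt with h0 | h0
    · have hz : (I x (ρα α)).trace = 0 := by rw [htr x _ hd.1, ← h0]; simp
      rw [(hpsd x _ hd.1).trace_eq_zero_iff.1 hz]
      exact ⟨0, by simp⟩
    · have h1 := (hqc _ hd hp x h0).isROne.smul h0.le
      rw [← htr x _ hd.1, smul_smul, mul_inv_cancel₀, one_smul] at h1
      · exact h1
      · rw [htr x _ hd.1]; exact_mod_cast h0.ne'
  have hlin : ∀ x, I x ρ = ∑ α, (w α : ℂ) • I x (ρα α) := by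
    intro x; rw [hdecomp, map_sum]; simp
  have hSρ : vnEntropy ρ = ∑ α, Real.negMulLog (w α) := by
    rw [hdecomp, vnEntropy_sum_eq _ (fun α => (hpure α).2.isROne.smul (hw α).le)]
    · simp [Matrix.trace_smul, (hpure _).1.2]
    · intro a b hab
      simp [horth a b hab]
  rw [hSρ]
  refine classical_core w (fun x α => (I x (ρα α)).trace.re) (fun x => (I x ρ).trace.re) hw hwsum
    (fun x α => hnn x _ (hpure α).1.1) ?_ ?_ _ ?_
  · intro x
    simp [hlin, Matrix.trace_sum, Matrix.trace_smul]
  · intro α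
    have h1 : ∑ x, (I x (ρα α)).trace = 1 := by
      have : ∀ x, (I x (ρα α)).trace = ((∑ i, (V x i)ᴴ * V x i) * ρα α).trace := by
        intro x
        rw [hKraus, Matrix.trace_sum, Finset.sum_mul, Matrix.trace_sum]
        refine Finset.sum_congr rfl fun i _ => ?_
        rw [Matrix.trace_mul_comm, Matrix.mul_assoc]
      simp_rw [this]
      rw [← Matrix.trace_sum, ← Finset.sum_mul, hNorm, one_mul, (hpure α).1.2]
    have h2 := congrArg Complex.re h1
    simpa using h2
  · intro x hx
    have hx' : ((I x ρ).trace)⁻¹ • I x ρ =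
        ∑ α, ((w α / (I x ρ).trace.re : ℝ) : ℂ) • I x (ρα α) := by
      conv_lhs => rw [htr x ρ hρ.1]
      conv_lhs => rw [hlin x]
      rw [Finset.smul_sum]
      refine Finset.sum_congr rfl fun α _ => ?_
      rw [smul_smul, ← hlin x]
      congr 1
      push_cast
      rw [div_eq_inv_mul]
    rw [hx']
    refine (vnEntropy_sum_le _ fun α => (hone x α).smul (div_nonneg (hw α).le hx.le)).trans
      (le_of_eq ?_)
    refine Finset.sum_congr rfl fun α _ => ?_
    rw [Matrix.trace_smul, smul_eq_mul, Complex.re_ofReal_mul]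
    congr 1
    ring
end
end

section
/- Let (I_x)_{x∈X} and (J_y)_{y∈Y} be quasi-complete discrete instruments on ℂ^d. Then the composed instrument (K_{(x,y)})_{(x,y)∈X×Y} defined by K_{(x,y)} = J_y ∘ I_x is a quasi-complete discrete instrument, and for every density matrix ρ its information gain dominates that of the first instrument: S(ρ) − Σ_{(x,y): q_{xy}>0} q_{xy} S(ρ_{xy}) ≥ S(ρ) − Σ_{x: p_x>0} p_x S(ρ_x), where p_x = Tr I_x[ρ], ρ_x = I_x[ρ]/p_x, q_{xy} = Tr K_{(x,y)}[ρ], and ρ_{xy} = K_{(x,y)}[ρ]/q_{xy}. -/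
open Matrix
open scoped ComplexOrder
noncomputable section

lemma qc_exists_sq {d : ℕ} {ρ : Matrix (Fin d) (Fin d) ℂ} (h : ρ.PosSemidef) :
    ∃ B : Matrix (Fin d) (Fin d) ℂ, ρ = Bᴴ * B := by
  open scoped MatrixOrder in
  exact CStarAlgebra.nonneg_iff_eq_star_mul_self.mp h.nonneg

lemma qc_entropy_charpoly {d : ℕ} {A B : Matrix (Fin d) (Fin d) ℂ}
    (hA : A.IsHermitian) (hB : B.IsHermitian) (h : A.charpoly = B.charpoly) :
    vnEntropy A = vnEntropy B := by
  have e := (IsHermitian.eigenvalues_eq_eigenvalues_iff hA hB).2 h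
  simp only [vnEntropy, dif_pos hA, dif_pos hB, e]

lemma qc_entropy_idem {d : ℕ} {A : Matrix (Fin d) (Fin d) ℂ}
    (h : A * A = A) : vnEntropy A = 0 := by
  unfold vnEntropy
  split_ifs with hA
  · refine Finset.sum_eq_zero fun i _ => ?_
    have h1 := hA.mulVec_eigenvectorBasis i
    have h2 : A *ᵥ (A *ᵥ ⇑(hA.eigenvectorBasis i)) = A *ᵥ ⇑(hA.eigenvectorBasis i) := by
      rw [mulVec_mulVec, h]
    rw [h1, mulVec_smul, h1, smul_smul] at h2
    have hne : (⇑(hA.eigenvectorBasis i) : Fin d → ℂ) ≠ 0 := by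
      intro h0
      apply hA.eigenvectorBasis.toBasis.ne_zero i
      ext k
      simpa using congrFun h0 k
    have h3 := smul_left_injective ℝ hne h2
    have h4 : hA.eigenvalues i * (hA.eigenvalues i - 1) = 0 := by linarith
    rcases mul_eq_zero.1 h4 with h5 | h5
    · simp [h5]
    · have : hA.eigenvalues i = 1 := by linarith
      simp [this]
  · rfl

lemma qc_entropy_nonneg {d : ℕ} {A : Matrix (Fin d) (Fin d) ℂ}
    (h : A.PosSemidef) (ht : A.trace = 1) : 0 ≤ vnEntropy A := by
  have hA := h.1
  rw [vnEntropy, dif_pos hA]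
  have hs : ∑ i, hA.eigenvalues i = 1 := by
    have := hA.trace_eq_sum_eigenvalues
    rw [ht] at this
    have := congrArg Complex.re this
    simpa using this.symm
  refine Finset.sum_nonneg fun i _ => Real.negMulLog_nonneg (h.eigenvalues_nonneg i) ?_
  rw [← hs]
  exact Finset.single_le_sum (f := hA.eigenvalues) (fun j _ => h.eigenvalues_nonneg j)
    (Finset.mem_univ i)

lemma qc_unitary_row {d : ℕ} {P : Matrix (Fin d) (Fin d) ℂ} (h : P * Pᴴ = 1) (i : Fin d) :
    ∑ k, ‖P i k‖ ^ 2 = 1 := by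
  have := congrFun (congrFun h i) i
  simp only [mul_apply, conjTranspose_apply, one_apply_eq, RCLike.star_def,
    Complex.mul_conj'] at this
  exact_mod_cast this

lemma qc_unitary_col {d : ℕ} {P : Matrix (Fin d) (Fin d) ℂ} (h : Pᴴ * P = 1) (i : Fin d) :
    ∑ k, ‖P k i‖ ^ 2 = 1 := by
  have := congrFun (congrFun h i) i
  simp only [mul_apply, conjTranspose_apply, one_apply_eq, RCLike.star_def,
    Complex.conj_mul'] at this
  exact_mod_cast this

lemma qc_peierls {d : ℕ} {A E : Matrix (Fin d) (Fin d) ℂ}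
    (h : A.PosSemidef) (hE : E * Eᴴ = 1) (hE' : Eᴴ * E = 1) :
    vnEntropy A ≤ ∑ i, Real.negMulLog ((Eᴴ * A * E) i i).re := by
  have hA := h.1
  rw [vnEntropy, dif_pos hA]
  obtain ⟨U, hU⟩ : ∃ U : Matrix (Fin d) (Fin d) ℂ, U = hA.eigenvectorUnitary := ⟨_, rfl⟩
  have hU1 : U * Uᴴ = 1 := by
    rw [hU]; exact Unitary.coe_mul_star_self _
  have hU2 : Uᴴ * U = 1 := by
    rw [hU]; exact Unitary.coe_star_mul_self _
  have hsp : A = U * diagonal (fun k => (hA.eigenvalues k : ℂ)) * Uᴴ := by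
    have := hA.spectral_theorem
    rw [Unitary.conjStarAlgAut_apply] at this
    rw [hU]; exact this
  set P := Eᴴ * U with hP
  have hPP : P * Pᴴ = 1 := by
    rw [hP, conjTranspose_mul, conjTranspose_conjTranspose, Matrix.mul_assoc,
      ← Matrix.mul_assoc U, hU1, Matrix.one_mul, hE']
  have hPP' : Pᴴ * P = 1 := by
    rw [hP, conjTranspose_mul, conjTranspose_conjTranspose, Matrix.mul_assoc,
      ← Matrix.mul_assoc E, hE, Matrix.one_mul, hU2]
  have hd : ∀ i, ((Eᴴ * A * E) i i).re = ∑ k, ‖P i k‖ ^ 2 * hA.eigenvalues k := by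
    intro i
    have e : Eᴴ * A * E = P * diagonal (fun k => (hA.eigenvalues k : ℂ)) * Pᴴ := by
      conv_lhs => rw [hsp]
      rw [hP, conjTranspose_mul, conjTranspose_conjTranspose]
      simp only [Matrix.mul_assoc]
    rw [e, mul_apply]
    simp only [mul_diagonal, conjTranspose_apply, RCLike.star_def]
    rw [Complex.re_sum]
    refine Finset.sum_congr rfl fun k _ => ?_
    rw [mul_right_comm, Complex.mul_conj']
    norm_cast
  calc ∑ k, Real.negMulLog (hA.eigenvalues k)
      = ∑ k, (∑ i, ‖P i k‖ ^ 2) * Real.negMulLog (hA.eigenvalues k) := by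
        simp only [qc_unitary_col hPP', one_mul]
    _ = ∑ i, ∑ k, ‖P i k‖ ^ 2 * Real.negMulLog (hA.eigenvalues k) := by
        rw [Finset.sum_comm]; simp only [Finset.sum_mul]
    _ ≤ _ := by
        refine Finset.sum_le_sum fun i _ => ?_
        rw [hd]
        exact Real.concaveOn_negMulLog.le_map_sum (fun k _ => by positivity)
          (qc_unitary_row hPP i) (fun k _ => h.eigenvalues_nonneg k)

lemma qc_concave {d : ℕ} {Y : Type*} [Fintype Y] (w : Y → ℝ)
    (σ : Y → Matrix (Fin d) (Fin d) ℂ) (hw : ∀ y, 0 ≤ w y) (hw1 : ∑ y, w y = 1)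
    (hσ : ∀ y, (σ y).PosSemidef) {ρ : Matrix (Fin d) (Fin d) ℂ} (hρ : ρ.IsHermitian)
    (h : ∑ y, (w y : ℂ) • σ y = ρ) :
    ∑ y, w y * vnEntropy (σ y) ≤ vnEntropy ρ := by
  obtain ⟨U, hU⟩ : ∃ U : Matrix (Fin d) (Fin d) ℂ, U = hρ.eigenvectorUnitary := ⟨_, rfl⟩
  have hU1 : U * Uᴴ = 1 := by
    rw [hU]; exact Unitary.coe_mul_star_self _
  have hU2 : Uᴴ * U = 1 := by
    rw [hU]; exact Unitary.coe_star_mul_self _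
  have hd : Uᴴ * ρ * U = diagonal (fun k => (hρ.eigenvalues k : ℂ)) := by
    have := hρ.conjStarAlgAut_star_eigenvectorUnitary
    rw [Unitary.conjStarAlgAut_star_apply] at this
    rw [hU]; exact this
  have he : ∀ i, hρ.eigenvalues i = ∑ y, w y * ((Uᴴ * σ y * U) i i).re := by
    intro i
    have h1 := congrArg Complex.re (congrFun (congrFun hd i) i)
    have h2 : Uᴴ * ρ * U = ∑ y, Uᴴ * ((w y : ℂ) • σ y) * U := by
      rw [← h, Matrix.mul_sum, Matrix.sum_mul]
    rw [h2, Matrix.sum_apply, Complex.re_sum] at h1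
    simp only [diagonal_apply_eq, Complex.ofReal_re, Matrix.mul_smul, Matrix.smul_mul,
      Matrix.smul_apply, smul_eq_mul, Complex.re_ofReal_mul] at h1
    exact h1.symm
  rw [vnEntropy, dif_pos hρ]
  calc ∑ y, w y * vnEntropy (σ y)
      ≤ ∑ y, w y * ∑ i, Real.negMulLog ((Uᴴ * σ y * U) i i).re :=
        Finset.sum_le_sum fun y _ =>
          mul_le_mul_of_nonneg_left (qc_peierls (hσ y) hU1 hU2) (hw y)
    _ = ∑ i, ∑ y, w y * Real.negMulLog ((Uᴴ * σ y * U) i i).re := by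
        simp only [Finset.mul_sum]; rw [Finset.sum_comm]
    _ ≤ _ := by
        refine Finset.sum_le_sum fun i _ => ?_
        rw [he]
        refine Real.concaveOn_negMulLog.le_map_sum (fun k _ => hw k) hw1 (fun y _ => ?_)
        have := ((hσ y).conjTranspose_mul_mul_same U).diag_nonneg (i := i)
        exact (Complex.le_def.1 this).1

lemma qc_tr {d : ℕ} {A : Matrix (Fin d) (Fin d) ℂ} (h : A.PosSemidef) :
    0 ≤ A.trace.re ∧ A.trace = (A.trace.re : ℂ) := by
  have := Complex.le_def.1 h.trace_nonneg
  exact ⟨this.1, Complex.ext rfl (by simpa using this.2.symm)⟩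

lemma qc_psd_zero {d : ℕ} {A : Matrix (Fin d) (Fin d) ℂ} (h : A.PosSemidef)
    (h0 : ¬ 0 < A.trace.re) : A = 0 := by
  have := qc_tr h
  rw [← h.trace_eq_zero_iff, this.2, le_antisymm (not_lt.1 h0) this.1]; simp

lemma qc_density {d : ℕ} {A : Matrix (Fin d) (Fin d) ℂ} (h : A.PosSemidef)
    (h0 : 0 < A.trace.re) : IsDensity (A.trace⁻¹ • A) := by
  have := qc_tr h
  constructor
  · refine h.smul ?_
    rw [this.2, ← Complex.ofReal_inv]
    exact_mod_cast inv_nonneg.2 this.1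
  · rw [trace_smul, smul_eq_mul, inv_mul_cancel₀]
    intro hh; rw [hh] at h0; simp at h0

lemma qc_concave' {d : ℕ} {Y : Type*} [Fintype Y]
    (A : Y → Matrix (Fin d) (Fin d) ℂ)
    (hA : ∀ y, (A y).PosSemidef) {ρ : Matrix (Fin d) (Fin d) ℂ} (hρ : IsDensity ρ)
    (h : ∑ y, A y = ρ) :
    ∑ y, (if 0 < (A y).trace.re then (A y).trace.re * vnEntropy ((A y).trace⁻¹ • A y) else 0)
      ≤ vnEntropy ρ := by
  classical
  have := qc_concave (fun y => (A y).trace.re)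
    (fun y => if 0 < (A y).trace.re then (A y).trace⁻¹ • A y else ρ)
    (fun y => (qc_tr (hA y)).1) ?_ ?_ hρ.1.1 ?_
  · refine le_trans (le_of_eq (Finset.sum_congr rfl fun y _ => ?_)) this
    split_ifs with h1
    · rfl
    · rw [le_antisymm (not_lt.1 h1) (qc_tr (hA y)).1, zero_mul]
  · rw [← Complex.re_sum, ← trace_sum, h, hρ.2]; simp
  · intro y
    split_ifs with h1
    · exact (qc_density (hA y) h1).1
    · exact hρ.1
  · rw [← h]
    refine Finset.sum_congr rfl fun y _ => ?_
    rw [← (qc_tr (hA y)).2]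
    split_ifs with h1
    · rw [smul_smul, mul_inv_cancel₀, one_smul]
      intro hh; rw [hh] at h1; simp at h1
    · rw [qc_psd_zero (hA y) h1]; simp

lemma qc_parallel {d n : ℕ} (v : Fin n → Fin d → ℂ) (M : Matrix (Fin d) (Fin d) ℂ)
    (hM : M = ∑ j, vecMulVec (v j) (star (v j))) (h : M * M = M.trace • M)
    (j k : Fin n) (a b : Fin d) : v j a * v k b = v j b * v k a := by
  have ht : (M * M).trace = M.trace * M.trace := by rw [h, trace_smul, smul_eq_mul]
  have hMab : ∀ a b, M a b = ∑ j, v j a * star (v j b) := by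
    intro a b; rw [hM, Matrix.sum_apply]; rfl
  have hs : ∑ a, ∑ b, ∑ j, ∑ k, (v j a * v k b - v j b * v k a) *
      star (v j a * v k b - v j b * v k a) = 0 := by
    have e : ∀ a b, ∑ j, ∑ k, (v j a * v k b - v j b * v k a) *
        star (v j a * v k b - v j b * v k a) =
        M a a * M b b + M b b * M a a - M a b * M b a - M b a * M a b := by
      intro a b
      simp only [hMab, Finset.sum_mul_sum, ← Finset.sum_add_distrib, ← Finset.sum_sub_distrib]
      refine Finset.sum_congr rfl fun j _ => Finset.sum_congr rfl fun k _ => ?_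
      simp only [star_sub, star_mul']
      ring
    simp only [e, Finset.sum_add_distrib, Finset.sum_sub_distrib]
    have t1 : ∑ a, ∑ b, M a a * M b b = M.trace * M.trace := by
      rw [trace, Finset.sum_mul_sum]; rfl
    have t2 : ∑ a, ∑ b, M b b * M a a = M.trace * M.trace := by
      rw [Finset.sum_comm]; exact t1
    have t3 : ∑ a, ∑ b, M a b * M b a = M.trace * M.trace := by
      rw [← ht, trace]; rfl
    have t4 : ∑ a, ∑ b, M b a * M a b = M.trace * M.trace := by
      rw [Finset.sum_comm]; exact t3
    rw [t1, t2, t3, t4]; ring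
  have hr : ∑ a, ∑ b, ∑ j, ∑ k, ‖v j a * v k b - v j b * v k a‖ ^ 2 = 0 := by
    simp only [RCLike.star_def, Complex.mul_conj'] at hs
    exact_mod_cast hs
  rw [Finset.sum_eq_zero_iff_of_nonneg (fun _ _ => by positivity)] at hr
  have hr := hr a (Finset.mem_univ _)
  rw [Finset.sum_eq_zero_iff_of_nonneg (fun _ _ => by positivity)] at hr
  have hr := hr b (Finset.mem_univ _)
  rw [Finset.sum_eq_zero_iff_of_nonneg (fun _ _ => by positivity)] at hr
  have hr := hr j (Finset.mem_univ _)
  rw [Finset.sum_eq_zero_iff_of_nonneg (fun _ _ => by positivity)] at hr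
  have hr := hr k (Finset.mem_univ _)
  exact sub_eq_zero.1 (by simpa using hr)

lemma qc_multiple {d : ℕ} {φ u : Fin d → ℂ} (hφ : φ ≠ 0)
    (h : ∀ a b, φ a * u b = φ b * u a) : ∃ c : ℂ, u = c • φ := by
  obtain ⟨a, ha⟩ := Function.ne_iff.1 hφ
  have ha : φ a ≠ 0 := ha
  refine ⟨u a / φ a, funext fun b => ?_⟩
  simp only [Pi.smul_apply, smul_eq_mul]
  field_simp
  linear_combination h a b

lemma qc_dichotomy {d : ℕ} (A B : Matrix (Fin d) (Fin d) ℂ)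
    (h : ∀ ψ a b, (A *ᵥ ψ) a * (B *ᵥ ψ) b = (A *ᵥ ψ) b * (B *ᵥ ψ) a)
    (ψ₀ : Fin d → ℂ) (h₀ : A *ᵥ ψ₀ ≠ 0) :
    (∃ c : ℂ, B = c • A) ∨
      ((∀ ψ, ∃ c : ℂ, A *ᵥ ψ = c • A *ᵥ ψ₀) ∧ (∀ ψ, ∃ c : ℂ, B *ᵥ ψ = c • A *ᵥ ψ₀)) := by
  obtain ⟨c, hc⟩ := qc_multiple h₀ (h ψ₀)
  obtain ⟨C, hC⟩ : ∃ C, C = B - c • A := ⟨_, rfl⟩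
  have hB : B = C + c • A := by rw [hC]; abel
  have hC0 : C *ᵥ ψ₀ = 0 := by rw [hC, sub_mulVec, hc, smul_mulVec, sub_self]
  have hAC : ∀ ψ a b, (A *ᵥ ψ) a * (C *ᵥ ψ) b = (A *ᵥ ψ) b * (C *ᵥ ψ) a := by
    intro ψ a b
    rw [hC]
    simp only [sub_mulVec, smul_mulVec, Pi.sub_apply, Pi.smul_apply, smul_eq_mul]
    linear_combination h ψ a b
  have hC1 : ∀ ψ, ∃ γ : ℂ, C *ᵥ ψ = γ • A *ᵥ ψ₀ := by
    intro ψ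
    refine qc_multiple h₀ fun a b => ?_
    have h1 := hAC (ψ + ψ₀) a b
    simp only [mulVec_add, hC0, Pi.add_apply, Pi.zero_apply, add_zero] at h1
    linear_combination h1 - hAC ψ a b
  by_cases hz : ∀ ψ, C *ᵥ ψ = 0
  · left
    refine ⟨c, ?_⟩
    have : C = 0 := by
      apply Matrix.ext_of_mulVec_single
      intro i; rw [hz, zero_mulVec]
    rw [hB, this, zero_add]
  · right
    push Not at hz
    obtain ⟨ψ₁, h1⟩ := hz
    have key : ∀ ψ, C *ᵥ ψ ≠ 0 → ∃ c : ℂ, A *ᵥ ψ = c • A *ᵥ ψ₀ := by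
      intro ψ hne
      obtain ⟨γ, hγ⟩ := hC1 ψ
      have hγ0 : γ ≠ 0 := by rintro rfl; rw [zero_smul] at hγ; exact hne hγ
      refine qc_multiple h₀ fun a b => ?_
      have h2 := hAC ψ b a
      rw [hγ] at h2
      simp only [Pi.smul_apply, smul_eq_mul] at h2
      apply mul_left_cancel₀ hγ0
      linear_combination h2
    have hA : ∀ ψ, ∃ c : ℂ, A *ᵥ ψ = c • A *ᵥ ψ₀ := by
      intro ψ
      by_cases hψ : C *ᵥ ψ = 0
      · obtain ⟨c1, hc1⟩ := key (ψ + ψ₁) (by rw [mulVec_add, hψ, zero_add]; exact h1)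
        obtain ⟨c2, hc2⟩ := key ψ₁ h1
        refine ⟨c1 - c2, ?_⟩
        rw [sub_smul, ← hc1, ← hc2, mulVec_add]; abel
      · exact key ψ hψ
    refine ⟨hA, fun ψ => ?_⟩
    obtain ⟨γ, hγ⟩ := hC1 ψ
    obtain ⟨c1, hc1⟩ := hA ψ
    refine ⟨γ + c * c1, ?_⟩
    rw [hB, add_mulVec, smul_mulVec, hγ, hc1, add_smul, smul_smul]

/-- Structure of families of operators whose values are everywhere parallel. -/
lemma qc_structure {d n : ℕ} (W : Fin n → Matrix (Fin d) (Fin d) ℂ)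
    (h : ∀ ψ j k a b, (W j *ᵥ ψ) a * (W k *ᵥ ψ) b = (W j *ᵥ ψ) b * (W k *ᵥ ψ) a) :
    (∃ (A : Matrix (Fin d) (Fin d) ℂ) (c : Fin n → ℂ), ∀ j, W j = c j • A) ∨
      (∃ (φ : Fin d → ℂ) (χ : Fin n → Fin d → ℂ), ∀ j, W j = vecMulVec φ (χ j)) := by
  by_cases hz : ∀ j, W j = 0
  · left; exact ⟨0, 0, fun j => by simp [hz j]⟩
  push Not at hz
  obtain ⟨j₀, hj⟩ := hz
  obtain ⟨ψ₀, h₀⟩ : ∃ ψ, W j₀ *ᵥ ψ ≠ 0 := by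
    by_contra hh
    push Not at hh
    apply hj
    apply Matrix.ext_of_mulVec_single
    intro i; rw [hh, zero_mulVec]
  have hd := fun k => qc_dichotomy (W j₀) (W k) (fun ψ => h ψ j₀ k) ψ₀ h₀
  by_cases hall : ∀ k, ∃ c : ℂ, W k = c • W j₀
  · left
    choose c hc using hall
    exact ⟨_, c, hc⟩
  · right
    push Not at hall
    obtain ⟨k, hk⟩ := hall
    have hA : ∀ ψ, ∃ c : ℂ, W j₀ *ᵥ ψ = c • W j₀ *ᵥ ψ₀ := by
      rcases hd k with ⟨c, hc⟩ | hc
      · exact absurd hc (hk c)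
      · exact hc.1
    have hW : ∀ l ψ, ∃ c : ℂ, W l *ᵥ ψ = c • W j₀ *ᵥ ψ₀ := by
      intro l ψ
      rcases hd l with ⟨c, hc⟩ | hc
      · obtain ⟨c1, hc1⟩ := hA ψ
        exact ⟨c * c1, by rw [hc, smul_mulVec, hc1, smul_smul]⟩
      · exact hc.2 ψ
    choose χ hχ using fun l i => hW l (Pi.single i 1)
    refine ⟨W j₀ *ᵥ ψ₀, χ, fun l => ?_⟩
    ext a b
    have := congrFun (hχ l b) a
    rw [mulVec_single_one] at this
    rw [vecMulVec_apply, mul_comm]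
    exact this

lemma qc_pure_vec {d : ℕ} (ψ : Fin d → ℂ) (hψ : ψ ≠ 0) :
    ∃ s : ℂ, s ≠ 0 ∧ IsDensity (s⁻¹ • vecMulVec ψ (star ψ)) ∧
      IsPure (s⁻¹ • vecMulVec ψ (star ψ)) := by
  have hp : (vecMulVec ψ (star ψ)).PosSemidef := posSemidef_vecMulVec_self_star ψ
  have hne : vecMulVec ψ (star ψ) ≠ 0 := by
    intro h0
    apply hψ
    funext a
    have := congrFun (congrFun h0 a) a
    simpa [vecMulVec_apply] using this
  have ht : 0 < (vecMulVec ψ (star ψ)).trace.re := by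
    by_contra h0; exact hne (qc_psd_zero hp h0)
  have hs : (vecMulVec ψ (star ψ)).trace ≠ 0 := by
    intro hh; rw [hh] at ht; simp at ht
  have hD := qc_density hp ht
  refine ⟨_, hs, hD, hD.1.1, ?_, ?_⟩
  · rw [Matrix.smul_mul, Matrix.mul_smul, vecMulVec_mul_vecMulVec]
    have : star ψ ⬝ᵥ ψ = (vecMulVec ψ (star ψ)).trace := by
      rw [trace_vecMulVec, dotProduct_comm]
    rw [this, vecMulVec_smul, smul_smul, smul_smul]
    congr 1
    field_simp
  · apply le_antisymm
    · rw [← smul_vecMulVec]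
      exact rank_vecMulVec_le _ _
    · rw [Nat.one_le_iff_ne_zero]
      intro h0
      have h0 : ((vecMulVec ψ (star ψ)).trace⁻¹ • vecMulVec ψ (star ψ)) = 0 := by
        rw [Matrix.rank, Submodule.finrank_eq_zero, LinearMap.range_eq_bot] at h0
        exact Matrix.ext_of_mulVec_single fun i => by
          rw [zero_mulVec]; exact LinearMap.congr_fun h0 _
      rcases smul_eq_zero.1 h0 with h1 | h1
      · exact inv_ne_zero hs h1
      · exact hne h1

lemma qc_kraus_psd {d n : ℕ} (W : Fin n → Matrix (Fin d) (Fin d) ℂ)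
    {ρ : Matrix (Fin d) (Fin d) ℂ} (h : ρ.PosSemidef) :
    (∑ j, W j * ρ * (W j)ᴴ).PosSemidef :=
  posSemidef_sum _ fun j _ => h.mul_mul_conjTranspose_same (W j)

lemma qc_struct_of_qc {d n : ℕ} (W : Fin n → Matrix (Fin d) (Fin d) ℂ)
    (J : Matrix (Fin d) (Fin d) ℂ →ₗ[ℂ] Matrix (Fin d) (Fin d) ℂ)
    (hK : ∀ ρ, J ρ = ∑ j, W j * ρ * (W j)ᴴ)
    (hqc : ∀ σ : Matrix (Fin d) (Fin d) ℂ, IsDensity σ → IsPure σ →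
      0 < (J σ).trace.re → IsPure (((J σ).trace)⁻¹ • J σ)) :
    (∃ (A : Matrix (Fin d) (Fin d) ℂ) (c : Fin n → ℂ), ∀ j, W j = c j • A) ∨
      (∃ (φ : Fin d → ℂ) (χ : Fin n → Fin d → ℂ), ∀ j, W j = vecMulVec φ (χ j)) := by
  apply qc_structure
  intro ψ
  by_cases hψ : ψ = 0
  · simp [hψ]
  obtain ⟨s, hs, hD, hP⟩ := qc_pure_vec ψ hψ
  apply qc_parallel (fun j => W j *ᵥ ψ) (J (vecMulVec ψ (star ψ)))
  · rw [hK]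
    refine Finset.sum_congr rfl fun j _ => ?_
    rw [mul_vecMulVec, vecMulVec_mul, star_mulVec]
  · set N := J (s⁻¹ • vecMulVec ψ (star ψ)) with hN
    have hJ : J (vecMulVec ψ (star ψ)) = s • N := by
      rw [hN, map_smul, smul_smul, mul_inv_cancel₀ hs, one_smul]
    have hNN : N * N = N.trace • N := by
      by_cases ht : 0 < N.trace.re
      · have h1 := (hqc _ hD hP ht).2.1
        have hne : N.trace ≠ 0 := by intro hh; rw [hh] at ht; simp at ht
        rw [← hN, Matrix.smul_mul, Matrix.mul_smul] at h1
        have h2 := congrArg (fun Z => (N.trace * N.trace) • Z) h1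
        simp only [smul_smul] at h2
        convert h2 using 1
        · rw [show N.trace * N.trace * (N.trace⁻¹ * N.trace⁻¹) = 1 by field_simp, one_smul]
        · congr 1; field_simp
      · have : N = 0 := qc_psd_zero (by rw [hN, hK]; exact qc_kraus_psd W hD.1) ht
        rw [this]; simp
    rw [hJ, Matrix.smul_mul, Matrix.mul_smul, hNN, trace_smul]
    simp only [smul_smul, smul_eq_mul]
    congr 1; ring

/-- Entropy comparison for a single outcome. -/
lemma qc_entropy_outcome {d n : ℕ} (W : Fin n → Matrix (Fin d) (Fin d) ℂ)
    (hW : (∃ (A : Matrix (Fin d) (Fin d) ℂ) (c : Fin n → ℂ), ∀ j, W j = c j • A) ∨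
      (∃ (φ : Fin d → ℂ) (χ : Fin n → Fin d → ℂ), ∀ j, W j = vecMulVec φ (χ j)))
    (B M N : Matrix (Fin d) (Fin d) ℂ)
    (hM : M = ∑ j, W j * (Bᴴ * B) * (W j)ᴴ)
    (hN : N = B * (∑ j, (W j)ᴴ * W j) * Bᴴ)
    (hMp : M.PosSemidef) (hNp : N.PosSemidef)
    (htr : M.trace = N.trace) (hpos : 0 < M.trace.re) :
    vnEntropy (M.trace⁻¹ • M) ≤ vnEntropy (N.trace⁻¹ • N) := by
  have hDM := qc_density hMp hpos
  have hDN := qc_density hNp (htr ▸ hpos)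
  rcases hW with ⟨A, c, hA⟩ | ⟨φ, χ, hφ⟩
  · apply le_of_eq
    apply qc_entropy_charpoly hDM.1.1 hDN.1.1
    have e1 : M = (∑ j, c j * star (c j)) • (A * Bᴴ * (B * Aᴴ)) := by
      rw [hM, Finset.sum_smul]
      refine Finset.sum_congr rfl fun j _ => ?_
      rw [hA, conjTranspose_smul]
      simp only [Matrix.smul_mul, Matrix.mul_smul, smul_smul, Matrix.mul_assoc]
      rw [mul_comm]
    have e2 : N = (∑ j, c j * star (c j)) • (B * Aᴴ * (A * Bᴴ)) := by
      rw [hN, Finset.sum_smul, Matrix.mul_sum, Matrix.sum_mul]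
      refine Finset.sum_congr rfl fun j _ => ?_
      rw [hA, conjTranspose_smul]
      simp only [Matrix.smul_mul, Matrix.mul_smul, smul_smul, Matrix.mul_assoc]
    rw [← htr]
    generalize M.trace⁻¹ = t
    rw [e1, e2, smul_smul, smul_smul, ← Matrix.smul_mul, charpoly_mul_comm, Matrix.mul_smul]
  · refine le_trans (le_of_eq (qc_entropy_idem ?_)) (qc_entropy_nonneg hDN.1 hDN.2)
    obtain ⟨s, hs⟩ : ∃ s : ℂ, M.trace⁻¹ • M = s • vecMulVec φ (star φ) := by
      refine ⟨M.trace⁻¹ * ∑ j, (χ j ᵥ* (Bᴴ * B)) ⬝ᵥ star (χ j), ?_⟩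
      rw [← smul_smul, Finset.sum_smul]
      congr 1
      rw [hM]
      refine Finset.sum_congr rfl fun j _ => ?_
      rw [hφ, vecMulVec_mul, conjTranspose_vecMulVec, vecMulVec_mul_vecMulVec, vecMulVec_smul]
    have h1 := hDM.2
    rw [hs, trace_smul, trace_vecMulVec, smul_eq_mul] at h1
    rw [hs, Matrix.smul_mul, Matrix.mul_smul, vecMulVec_mul_vecMulVec, vecMulVec_smul,
      smul_smul, smul_smul, dotProduct_comm, mul_assoc, h1, mul_one]

lemma qc_trace_eq {d n : ℕ} (W : Fin n → Matrix (Fin d) (Fin d) ℂ)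
    (B : Matrix (Fin d) (Fin d) ℂ) :
    (∑ j, W j * (Bᴴ * B) * (W j)ᴴ).trace = (B * (∑ j, (W j)ᴴ * W j) * Bᴴ).trace := by
  rw [Matrix.mul_sum, Matrix.sum_mul, trace_sum, trace_sum]
  refine Finset.sum_congr rfl fun j _ => ?_
  rw [show W j * (Bᴴ * B) * (W j)ᴴ = (W j * Bᴴ) * (B * (W j)ᴴ) by simp only [Matrix.mul_assoc],
    trace_mul_comm]
  simp only [Matrix.mul_assoc]

/-- Nonnegativity of the information gain of a quasi-complete instrument. -/
lemma qc_gain_nonneg {d : ℕ} {Y : Type*} [Fintype Y] {n : Y → ℕ}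
    (J : Y → (Matrix (Fin d) (Fin d) ℂ →ₗ[ℂ] Matrix (Fin d) (Fin d) ℂ))
    (W : (y : Y) → Fin (n y) → Matrix (Fin d) (Fin d) ℂ)
    (hKrausJ : ∀ y ρ, J y ρ = ∑ j, W y j * ρ * (W y j)ᴴ)
    (hNormJ : ∑ y, ∑ j, (W y j)ᴴ * W y j = 1)
    (hqcJ : ∀ σ : Matrix (Fin d) (Fin d) ℂ, IsDensity σ → IsPure σ →
      ∀ y, 0 < (J y σ).trace.re → IsPure (((J y σ).trace)⁻¹ • J y σ))
    (ρ : Matrix (Fin d) (Fin d) ℂ) (hρ : IsDensity ρ) :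
    ∑ y, (if 0 < (J y ρ).trace.re then
      (J y ρ).trace.re * vnEntropy (((J y ρ).trace)⁻¹ • J y ρ) else 0) ≤ vnEntropy ρ := by
  obtain ⟨B, rfl⟩ := qc_exists_sq hρ.1
  obtain ⟨A, hA⟩ : ∃ A : Y → Matrix (Fin d) (Fin d) ℂ,
      A = fun y => B * (∑ j, (W y j)ᴴ * W y j) * Bᴴ := ⟨_, rfl⟩
  have hAp : ∀ y, (A y).PosSemidef := by
    intro y
    rw [hA]
    exact (posSemidef_sum _ fun j _ => posSemidef_conjTranspose_mul_self
      (W y j)).mul_mul_conjTranspose_same B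
  have hsum : ∑ y, A y = B * Bᴴ := by
    rw [hA]
    simp only
    rw [← Matrix.sum_mul, ← Matrix.mul_sum, hNormJ, Matrix.mul_one]
  have hD : IsDensity (B * Bᴴ) :=
    ⟨posSemidef_self_mul_conjTranspose B, by rw [trace_mul_comm]; exact hρ.2⟩
  have hc := qc_concave' A hAp hD hsum
  rw [qc_entropy_charpoly hD.1.1 hρ.1.1 (charpoly_mul_comm _ _)] at hc
  refine le_trans (Finset.sum_le_sum fun y _ => ?_) hc
  have htr : (J y (Bᴴ * B)).trace = (A y).trace := by
    rw [hKrausJ, hA]; exact qc_trace_eq _ _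
  rw [← htr]
  split_ifs with h
  · refine mul_le_mul_of_nonneg_left ?_ h.le
    have := qc_entropy_outcome (W y)
      (qc_struct_of_qc (W y) (J y) (hKrausJ y) fun σ h1 h2 => hqcJ σ h1 h2 y)
      B (J y (Bᴴ * B)) (A y) (hKrausJ y _) (by rw [hA])
      (by rw [hKrausJ]; exact qc_kraus_psd _ hρ.1) (hAp y) htr h
    rw [← htr] at this
    exact this
  · exact le_rfl

/-- Rescaling by a nonzero trace. -/
lemma qc_rescale {d : ℕ} (J : Matrix (Fin d) (Fin d) ℂ →ₗ[ℂ] Matrix (Fin d) (Fin d) ℂ)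
    (A : Matrix (Fin d) (Fin d) ℂ) (t : ℂ) (ht : t ≠ 0) :
    (J (t⁻¹ • A)).trace⁻¹ • J (t⁻¹ • A) = (J A).trace⁻¹ • J A := by
  rw [map_smul, trace_smul, smul_smul, smul_eq_mul]
  congr 1
  rw [mul_inv, inv_inv]; field_simp

/-- If `(I_x)_{x∈X}` and `(J_y)_{y∈Y}` are quasi-complete discrete instruments on `ℂ^d`,
then the composed instrument `K_{(x,y)} = J_y ∘ I_x` is a quasi-complete discrete
instrument (with Kraus operators `W_{y,j} V_{x,i}` and the correct normalization),
and for every density matrix `ρ` its information gain dominates that of the first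
instrument:
`S(ρ) − ∑_{(x,y) : q_{xy}>0} q_{xy} S(ρ_{xy}) ≥ S(ρ) − ∑_{x : p_x>0} p_x S(ρ_x)`. -/
theorem composed_instrument_quasiComplete_and_info_gain_mono
    {d : ℕ} {X Y : Type*} [Fintype X] [Fintype Y] {m : X → ℕ} {n : Y → ℕ}
    (I : X → (Matrix (Fin d) (Fin d) ℂ →ₗ[ℂ] Matrix (Fin d) (Fin d) ℂ))
    (J : Y → (Matrix (Fin d) (Fin d) ℂ →ₗ[ℂ] Matrix (Fin d) (Fin d) ℂ))
    (V : (x : X) → Fin (m x) → Matrix (Fin d) (Fin d) ℂ)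
    (W : (y : Y) → Fin (n y) → Matrix (Fin d) (Fin d) ℂ)
    (hKrausI : ∀ x ρ, I x ρ = ∑ i, V x i * ρ * (V x i)ᴴ)
    (hKrausJ : ∀ y ρ, J y ρ = ∑ j, W y j * ρ * (W y j)ᴴ)
    (hNormI : ∑ x, ∑ i, (V x i)ᴴ * V x i = 1)
    (hNormJ : ∑ y, ∑ j, (W y j)ᴴ * W y j = 1)
    (hqcI : ∀ σ : Matrix (Fin d) (Fin d) ℂ, IsDensity σ → IsPure σ →
      ∀ x, 0 < (I x σ).trace.re → IsPure (((I x σ).trace)⁻¹ • I x σ))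
    (hqcJ : ∀ σ : Matrix (Fin d) (Fin d) ℂ, IsDensity σ → IsPure σ →
      ∀ y, 0 < (J y σ).trace.re → IsPure (((J y σ).trace)⁻¹ • J y σ)) :
    -- the composed maps `K_{(x,y)} = J_y ∘ I_x` form a discrete instrument, with
    -- Kraus operators `W_{y,j} * V_{x,i}` and the correct normalization:
    (∀ (p : X × Y) (ρ : Matrix (Fin d) (Fin d) ℂ),
      (J p.2 ∘ₗ I p.1) ρ = ∑ j, ∑ i, (W p.2 j * V p.1 i) * ρ * (W p.2 j * V p.1 i)ᴴ) ∧
    (∑ p : X × Y, ∑ j, ∑ i, (W p.2 j * V p.1 i)ᴴ * (W p.2 j * V p.1 i) = 1) ∧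
    -- the composed instrument is quasi-complete:
    (∀ σ : Matrix (Fin d) (Fin d) ℂ, IsDensity σ → IsPure σ →
      ∀ p : X × Y, 0 < ((J p.2 ∘ₗ I p.1) σ).trace.re →
        IsPure ((((J p.2 ∘ₗ I p.1) σ).trace)⁻¹ • (J p.2 ∘ₗ I p.1) σ)) ∧
    -- the information gain of the composed instrument dominates that of the first one:
    (∀ ρ : Matrix (Fin d) (Fin d) ℂ, IsDensity ρ →
      vnEntropy ρ - ∑ x, (if 0 < (I x ρ).trace.re then
          (I x ρ).trace.re * vnEntropy (((I x ρ).trace)⁻¹ • I x ρ) else 0) ≤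
      vnEntropy ρ - ∑ p : X × Y, (if 0 < ((J p.2 ∘ₗ I p.1) ρ).trace.re then
          ((J p.2 ∘ₗ I p.1) ρ).trace.re *
            vnEntropy ((((J p.2 ∘ₗ I p.1) ρ).trace)⁻¹ • (J p.2 ∘ₗ I p.1) ρ) else 0)) := by
  have hIp : ∀ x {σ : Matrix (Fin d) (Fin d) ℂ}, σ.PosSemidef → (I x σ).PosSemidef := by
    intro x σ h; rw [hKrausI]; exact qc_kraus_psd _ h
  have hne : ∀ {A : Matrix (Fin d) (Fin d) ℂ}, 0 < A.trace.re → A.trace ≠ 0 := by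
    intro A h hh; rw [hh] at h; simp at h
  refine ⟨?_, ?_, ?_, ?_⟩
  · intro p ρ
    rw [LinearMap.comp_apply, hKrausI, hKrausJ]
    refine Finset.sum_congr rfl fun j _ => ?_
    rw [Matrix.mul_sum, Matrix.sum_mul]
    refine Finset.sum_congr rfl fun i _ => ?_
    rw [conjTranspose_mul]
    simp only [Matrix.mul_assoc]
  · rw [Fintype.sum_prod_type, ← hNormI]
    refine Finset.sum_congr rfl fun x _ => ?_
    calc ∑ y, ∑ j, ∑ i, (W y j * V x i)ᴴ * (W y j * V x i)
        = ∑ y, ∑ i, ∑ j, (V x i)ᴴ * ((W y j)ᴴ * W y j) * V x i := by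
          refine Finset.sum_congr rfl fun y _ => ?_
          rw [Finset.sum_comm]
          simp only [conjTranspose_mul, Matrix.mul_assoc]
      _ = ∑ i, (V x i)ᴴ * (∑ y, ∑ j, (W y j)ᴴ * W y j) * V x i := by
          rw [Finset.sum_comm]
          simp only [Matrix.mul_sum, Matrix.sum_mul]
      _ = _ := by simp only [hNormJ, Matrix.mul_one]
  · intro σ hD hP p hpos
    simp only [LinearMap.comp_apply] at hpos ⊢
    have hp : 0 < (I p.1 σ).trace.re := by
      by_contra h0
      rw [qc_psd_zero (hIp _ hD.1) h0] at hpos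
      simp at hpos
    rw [← qc_rescale (J p.2) (I p.1 σ) _ (hne hp)]
    refine hqcJ _ (qc_density (hIp _ hD.1) hp) (hqcI σ hD hP p.1 hp) p.2 ?_
    rw [map_smul, trace_smul, (qc_tr (hIp p.1 hD.1)).2, ← Complex.ofReal_inv, smul_eq_mul,
      Complex.re_ofReal_mul]
    exact mul_pos (inv_pos.2 hp) hpos
  · intro ρ hD
    apply sub_le_sub_left
    rw [Fintype.sum_prod_type]
    refine Finset.sum_le_sum fun x _ => ?_
    simp only [LinearMap.comp_apply]
    split_ifs with hp
    · have h := qc_gain_nonneg J W hKrausJ hNormJ hqcJ _ (qc_density (hIp x hD.1) hp)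
      refine le_trans (le_of_eq ?_) (mul_le_mul_of_nonneg_left h hp.le)
      rw [Finset.mul_sum]
      refine Finset.sum_congr rfl fun y _ => ?_
      rw [qc_rescale (J y) (I x ρ) _ (hne hp)]
      have ht : (J y ((I x ρ).trace⁻¹ • I x ρ)).trace.re
          = ((I x ρ).trace.re)⁻¹ * (J y (I x ρ)).trace.re := by
        rw [map_smul, trace_smul, (qc_tr (hIp x hD.1)).2, ← Complex.ofReal_inv, smul_eq_mul,
          Complex.re_ofReal_mul, Complex.ofReal_re]
      rw [ht]
      have hiff : 0 < ((I x ρ).trace.re)⁻¹ * (J y (I x ρ)).trace.re ↔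
          0 < (J y (I x ρ)).trace.re := mul_pos_iff_of_pos_left (inv_pos.2 hp)
      simp only [hiff]
      split_ifs
      · field_simp
      · simp
    · rw [qc_psd_zero (hIp x hD.1) hp]
      simp
end
end
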